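/- arXiv:1707.04829 — 8 statements merged into one kernel-verified Lean document; each statement's English description precedes it below -/
import Mathlib

section
/- For every natural number d and every finite acute set X in ℝ^d, there exists a finite acute set Y in ℝ^{d+2} with |Y| = 2·|X|. Consequently f(d+2) ≥ 2·f(d), where f(d) denotes the maximum size of an acute set in ℝ^d. -/
open scoped RealInnerProductSpace

/-- A set of points in a real inner product space is *acute* if any three pairwise distinct
points of it form an acute triangle, i.e. every angle they determine is less than `π/2`. -/
def IsAcuteSet {V : Type*} [NormedAddCommGroup V] [InnerProductSpace ℝ V] (S : Set V) : Prop :=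
  ∀ a ∈ S, ∀ b ∈ S, ∀ c ∈ S, a ≠ b → a ≠ c → b ≠ c →
    EuclideanGeometry.angle a b c < Real.pi / 2

/-- `maxAcuteCard d` is the maximum size `f(d)` of an acute set in `ℝ^d`. -/
noncomputable def maxAcuteCard (d : ℕ) : ℕ :=
  sSup {n : ℕ | ∃ X : Finset (EuclideanSpace ℝ (Fin d)),
    IsAcuteSet (X : Set (EuclideanSpace ℝ (Fin d))) ∧ X.card = n}

theorem isAcuteSet_iff_inner_pos {V : Type*} [NormedAddCommGroup V] [InnerProductSpace ℝ V]
    {S : Set V} :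
    IsAcuteSet S ↔ ∀ a ∈ S, ∀ b ∈ S, ∀ c ∈ S, a ≠ b → a ≠ c → b ≠ c →
      0 < ⟪a - b, c - b⟫ := by
  have key (a b c : V) (hab : a ≠ b) (hbc : b ≠ c) :
      EuclideanGeometry.angle a b c < Real.pi / 2 ↔ 0 < ⟪a - b, c - b⟫ := by
    have h : 0 < ‖a - b‖ * ‖c - b‖ :=
      mul_pos (norm_pos_iff.2 (sub_ne_zero.2 hab)) (norm_pos_iff.2 (sub_ne_zero.2 hbc.symm))
    rw [EuclideanGeometry.angle, InnerProductGeometry.angle, Real.arccos_lt_pi_div_two,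
      vsub_eq_sub, vsub_eq_sub, div_pos_iff_of_pos_right h]
  constructor
  · intro hS a ha b hb c hc hab hac hbc
    exact (key a b c hab hbc).1 (hS a ha b hb c hc hab hac hbc)
  · intro hS a ha b hb c hc hab hac hbc
    exact (key a b c hab hbc).2 (hS a ha b hb c hc hab hac hbc)

/-- The set of sign patterns of the vectors from `x` to the other points of `X` determines `x`
when `X` is acute. -/
theorem IsAcuteSet.card_le {d : ℕ} {X : Finset (EuclideanSpace ℝ (Fin d))}
    (hX : IsAcuteSet (X : Set (EuclideanSpace ℝ (Fin d)))) : X.card ≤ 2 ^ 2 ^ d := by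
  classical
  rw [isAcuteSet_iff_inner_pos] at hX
  let pattern (x y : EuclideanSpace ℝ (Fin d)) : Fin d → Bool := fun i => decide (x i ≤ y i)
  let out (x : EuclideanSpace ℝ (Fin d)) : Finset (Fin d → Bool) :=
    (X.erase x).image (pattern x)
  have hout : Set.InjOn out X := by
    intro x hx y hy hxy
    by_contra hne
    have hmem : pattern x y ∈ out y := by
      rw [← hxy]
      exact Finset.mem_image_of_mem _ (Finset.mem_erase.2 ⟨Ne.symm hne, hy⟩)
    obtain ⟨z, hz, hzy⟩ := Finset.mem_image.1 hmem
    obtain ⟨hzne, hzX⟩ := Finset.mem_erase.1 hz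
    have hp (i : Fin d) : y i ≤ z i ↔ x i ≤ y i := by
      simpa [pattern] using congrFun hzy i
    have hxz : x ≠ z := by
      rintro rfl
      apply hne
      ext i
      rcases le_total (x i) (y i) with h | h
      · exact le_antisymm h ((hp i).2 h)
      · exact le_antisymm ((hp i).1 h) h
    have hpos := hX x hx y hy z hzX hne hxz hzne.symm
    refine absurd hpos (not_lt.2 ?_)
    rw [PiLp.inner_apply]
    refine Finset.sum_nonpos fun i _ => ?_
    have hi := hp i
    simp only [PiLp.sub_apply, RCLike.inner_apply, conj_trivial]
    by_cases h : x i ≤ y i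
    · have := hi.2 h
      exact mul_nonpos_of_nonneg_of_nonpos (by linarith) (by linarith)
    · have := not_le.1 (mt hi.1 h)
      exact mul_nonpos_of_nonpos_of_nonneg (by linarith) (by linarith)
  calc X.card = (X.image out).card := (Finset.card_image_of_injOn hout).symm
    _ ≤ Fintype.card (Finset (Fin d → Bool)) := Finset.card_le_univ _
    _ = 2 ^ 2 ^ d := by simp

/-- The point of `ℝ^(d+2)` obtained by appending two coordinates to a point of `ℝ^d`. -/
noncomputable def appendTwo {d : ℕ} (x : EuclideanSpace ℝ (Fin d)) (p q : ℝ) :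
    EuclideanSpace ℝ (Fin (d + 2)) :=
  WithLp.toLp 2 (Fin.snoc (Fin.snoc (fun i => x i) p : Fin (d + 1) → ℝ) q : Fin (d + 2) → ℝ)

theorem inner_appendTwo_sub {d : ℕ} (x y z : EuclideanSpace ℝ (Fin d)) (p q p' q' p'' q'' : ℝ) :
    ⟪appendTwo x p q - appendTwo y p' q', appendTwo z p'' q'' - appendTwo y p' q'⟫ =
      ⟪x - y, z - y⟫ + ((p - p') * (p'' - p') + (q - q') * (q'' - q')) := by
  simp only [PiLp.inner_apply, appendTwo, PiLp.sub_apply, RCLike.inner_apply, conj_trivial,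
    Fin.sum_univ_castSucc, Fin.snoc_castSucc, Fin.snoc_last]
  ring

theorem appendTwo_inj {d : ℕ} {x y : EuclideanSpace ℝ (Fin d)} {p q p' q' : ℝ} :
    appendTwo x p q = appendTwo y p' q' ↔ x = y ∧ p = p' ∧ q = q' := by
  constructor
  · intro h
    rw [appendTwo, appendTwo, WithLp.toLp_injective 2 |>.eq_iff, Fin.snoc_inj, Fin.snoc_inj] at h
    exact ⟨PiLp.ext fun i => congrFun h.1.1 i, h.1.2, h.2⟩
  · rintro ⟨rfl, rfl, rfl⟩
    rfl

/-- Distinct points of a finite set can be assigned distinct lines through the origin in the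
plane, each given by a unit vector `(p, q)` spanning it. -/
theorem exists_unit_vectors_pairwise_independent {α : Type*} (X : Finset α) :
    ∃ p q : α → ℝ, (∀ x, 0 < p x) ∧ (∀ x, p x ^ 2 + q x ^ 2 = 1) ∧
      ∀ x ∈ X, ∀ y ∈ X, x ≠ y → |p x * p y + q x * q y| < 1 := by
  obtain ⟨t, ht⟩ := Set.countable_iff_exists_injOn.1 X.countable_toSet
  have hpos (x : α) : (0 : ℝ) < 1 + (t x : ℝ) ^ 2 := by positivity
  have hp (x : α) : ((√(1 + (t x : ℝ) ^ 2))⁻¹) ^ 2 * (1 + (t x : ℝ) ^ 2) = 1 := by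
    rw [inv_pow, Real.sq_sqrt (hpos x).le, inv_mul_cancel₀ (hpos x).ne']
  generalize hP : (fun x : α => (√(1 + (t x : ℝ) ^ 2))⁻¹) = p at *
  have hp0 (x : α) : 0 < p x := by
    rw [← hP]
    exact inv_pos.2 (Real.sqrt_pos.2 (hpos x))
  have hp1 (x : α) : p x ^ 2 + (t x * p x) ^ 2 = 1 := by
    rw [← hp x, ← hP]
    ring
  refine ⟨p, fun x => t x * p x, hp0, hp1, fun x hx y hy hxy => ?_⟩
  have hne : (t y : ℝ) - t x ≠ 0 :=
    sub_ne_zero.2 fun h => hxy (ht hx hy (Nat.cast_injective h).symm)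
  have hdet : 0 < (p x * p y * (t y - t x)) ^ 2 := by
    have := (hp0 x).ne'
    have := (hp0 y).ne'
    positivity
  rw [← sq_lt_one_iff_abs_lt_one]
  have hlag : (p x * p y + t x * p x * (t y * p y)) ^ 2 + (p x * p y * (t y - t x)) ^ 2 =
      (p x ^ 2 + (t x * p x) ^ 2) * (p y ^ 2 + (t y * p y) ^ 2) := by ring
  rw [hp1, hp1] at hlag
  linarith

/-- In the plane, if `a` and `c` are unit vectors, then `⟪a - b, c - b⟫ ≥ -1` for every `b`. -/
theorem neg_one_le_of_unit {a c a' c' : ℝ} (b b' : ℝ)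
    (ha : a ^ 2 + a' ^ 2 = 1) (hc : c ^ 2 + c' ^ 2 = 1) :
    -1 ≤ (a - b) * (c - b) + (a' - b') * (c' - b') := by
  nlinarith [sq_nonneg (a + c - 2 * b), sq_nonneg (a' + c' - 2 * b'), sq_nonneg (a + c),
    sq_nonneg (a' + c')]

theorem IsAcuteSet.exists_pos_lt_inner {V : Type*} [NormedAddCommGroup V] [InnerProductSpace ℝ V]
    {X : Finset V} (hX : IsAcuteSet (X : Set V)) :
    ∃ ε : ℝ, 0 < ε ∧ ∀ x ∈ X, ∀ y ∈ X, ∀ z ∈ X, x ≠ y → x ≠ z → y ≠ z →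
      ε ^ 2 < ⟪x - y, z - y⟫ := by
  rw [isAcuteSet_iff_inner_pos] at hX
  have hlim : Filter.Tendsto (fun ε : ℝ => ε ^ 2) (nhdsWithin 0 (Set.Ioi 0)) (nhds 0) := by
    have : Continuous fun ε : ℝ => ε ^ 2 := by fun_prop
    simpa using (this.tendsto 0).mono_left nhdsWithin_le_nhds
  have hev : ∀ᶠ ε : ℝ in nhdsWithin 0 (Set.Ioi 0), ∀ x ∈ X, ∀ y ∈ X, ∀ z ∈ X,
      x ≠ y → x ≠ z → y ≠ z → ε ^ 2 < ⟪x - y, z - y⟫ := by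
    simp only [Filter.eventually_all_finset, Filter.eventually_imp_distrib_left]
    intro x hx y hy z hz hxy hxz hyz
    exact hlim.eventually_lt_const (hX x hx y hy z hz hxy hxz hyz)
  obtain ⟨ε, h, hε⟩ := (hev.and self_mem_nhdsWithin).exists
  exact ⟨ε, hε, h⟩

theorem IsAcuteSet.exists_double {d : ℕ} {X : Finset (EuclideanSpace ℝ (Fin d))}
    (hX : IsAcuteSet (X : Set (EuclideanSpace ℝ (Fin d)))) :
    ∃ Y : Finset (EuclideanSpace ℝ (Fin (d + 2))),
      IsAcuteSet (Y : Set (EuclideanSpace ℝ (Fin (d + 2)))) ∧ Y.card = 2 * X.card := by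
  classical
  obtain ⟨ε, hε, hX⟩ := hX.exists_pos_lt_inner
  obtain ⟨p, q, hp, hpq, hlt⟩ := exists_unit_vectors_pairwise_independent X
  let f (w : EuclideanSpace ℝ (Fin d) × ℤˣ) : EuclideanSpace ℝ (Fin (d + 2)) :=
    appendTwo w.1 (ε * (((w.2 : ℤ) : ℝ) * p w.1)) (ε * (((w.2 : ℤ) : ℝ) * q w.1))
  have hsq (s : ℤˣ) : (((s : ℤ) : ℝ)) ^ 2 = 1 := by
    rcases Int.units_eq_one_or s with rfl | rfl <;> norm_num
  have hf : Function.Injective f := by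
    rintro ⟨x, s⟩ ⟨y, r⟩ h
    obtain ⟨rfl, h, -⟩ := appendTwo_inj.1 h
    have := mul_right_cancel₀ (hp x).ne' (mul_left_cancel₀ hε.ne' h)
    simpa [Units.ext_iff] using this
  have hunit (x : EuclideanSpace ℝ (Fin d)) (s : ℤˣ) :
      (((s : ℤ) : ℝ) * p x) ^ 2 + (((s : ℤ) : ℝ) * q x) ^ 2 = 1 := by
    rw [mul_pow, mul_pow, hsq, one_mul, one_mul, hpq]
  have hdot {x y : EuclideanSpace ℝ (Fin d)} (hx : x ∈ X) (hy : y ∈ X) (hxy : x ≠ y)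
      (s r : ℤˣ) : (((s : ℤ) : ℝ) * p x) * (((r : ℤ) : ℝ) * p y) +
        (((s : ℤ) : ℝ) * q x) * (((r : ℤ) : ℝ) * q y) < 1 := by
    have := abs_lt.1 (hlt x hx y hy hxy)
    rcases Int.units_eq_one_or s with rfl | rfl <;>
      rcases Int.units_eq_one_or r with rfl | rfl <;> push_cast <;> linarith
  have hneg {s r : ℤˣ} (h : s ≠ r) : ((s : ℤ) : ℝ) = -((r : ℤ) : ℝ) := by
    rw [Int.units_ne_iff_eq_neg.1 h]
    push_cast
    rfl
  have hinner (x y z : EuclideanSpace ℝ (Fin d)) (s r t : ℤˣ) :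
      ⟪f (x, s) - f (y, r), f (z, t) - f (y, r)⟫ = ⟪x - y, z - y⟫ + ε ^ 2 *
        ((((s : ℤ) : ℝ) * p x - ((r : ℤ) : ℝ) * p y) *
            (((t : ℤ) : ℝ) * p z - ((r : ℤ) : ℝ) * p y) +
          (((s : ℤ) : ℝ) * q x - ((r : ℤ) : ℝ) * q y) *
            (((t : ℤ) : ℝ) * q z - ((r : ℤ) : ℝ) * q y)) := by
    rw [inner_appendTwo_sub]
    ring
  have hright {x z : EuclideanSpace ℝ (Fin d)} (hx : x ∈ X) (hz : z ∈ X) (hxz : x ≠ z)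
      {s r : ℤˣ} (hsr : s ≠ r) (t : ℤˣ) :
      0 < ⟪f (x, s) - f (x, r), f (z, t) - f (x, r)⟫ := by
    rw [hinner, sub_self, inner_zero_left, zero_add, hneg hsr]
    have h1 := hdot hx hz hxz r t
    have h2 := hunit x r
    refine mul_pos (by positivity) ?_
    linear_combination 2 * h1 - 2 * h2
  refine ⟨(X ×ˢ Finset.univ).image f, ?_, ?_⟩
  · rw [isAcuteSet_iff_inner_pos]
    intro a ha b hb c hc hab hac hbc
    simp only [Finset.coe_image, Set.mem_image, Finset.mem_coe, Finset.mem_product,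
      Finset.mem_univ, and_true] at ha hb hc
    obtain ⟨⟨x, s⟩, hx, rfl⟩ := ha
    obtain ⟨⟨y, r⟩, hy, rfl⟩ := hb
    obtain ⟨⟨z, t⟩, hz, rfl⟩ := hc
    dsimp only at hx hy hz
    have sign_ne {w : EuclideanSpace ℝ (Fin d)} {i j : ℤˣ} (h : f (w, i) ≠ f (w, j)) : i ≠ j :=
      fun hij => h (by rw [hij])
    by_cases hxy : x = y
    · subst hxy
      by_cases hxz : x = z
      · subst hxz
        have h1 := Int.units_ne_iff_eq_neg.1 (sign_ne hab)
        have h2 := Int.units_ne_iff_eq_neg.1 (sign_ne hbc)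
        exact absurd (by rw [h1, h2, neg_neg]) (sign_ne hac)
      · exact hright hx hz hxz (sign_ne hab) t
    by_cases hyz : y = z
    · subst hyz
      rw [real_inner_comm]
      exact hright hy hx (Ne.symm hxy) (sign_ne hbc).symm s
    by_cases hxz : x = z
    · subst hxz
      rw [hinner, hneg (sign_ne hac)]
      have h0 : 0 < ⟪x - y, x - y⟫ := real_inner_self_pos.2 (sub_ne_zero.2 hxy)
      have h1 := hunit x t
      have h2 := hunit y r
      linear_combination h0 + ε ^ 2 * (h1 - h2)
    · rw [hinner]
      have h1 := hX x hx y hy z hz hxy hxz hyz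
      have h2 := mul_le_mul_of_nonneg_left
        (neg_one_le_of_unit (((r : ℤ) : ℝ) * p y) (((r : ℤ) : ℝ) * q y) (hunit x s) (hunit z t))
        (sq_nonneg ε)
      linarith
  · rw [Finset.card_image_of_injective _ hf, Finset.card_product, Finset.card_univ,
      Fintype.card_units_int, mul_comm]

theorem IsAcuteSet.card_le_maxAcuteCard {d : ℕ} {X : Finset (EuclideanSpace ℝ (Fin d))}
    (hX : IsAcuteSet (X : Set (EuclideanSpace ℝ (Fin d)))) : X.card ≤ maxAcuteCard d := by
  refine le_csSup ⟨2 ^ 2 ^ d, ?_⟩ ⟨X, hX, rfl⟩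
  rintro _ ⟨Z, hZ, rfl⟩
  exact hZ.card_le

theorem exists_card_eq_maxAcuteCard (d : ℕ) :
    ∃ X : Finset (EuclideanSpace ℝ (Fin d)),
      IsAcuteSet (X : Set (EuclideanSpace ℝ (Fin d))) ∧ X.card = maxAcuteCard d := by
  refine Nat.sSup_mem (s := {n : ℕ | ∃ X : Finset (EuclideanSpace ℝ (Fin d)),
    IsAcuteSet (X : Set (EuclideanSpace ℝ (Fin d))) ∧ X.card = n}) ?_ ⟨2 ^ 2 ^ d, ?_⟩
  · exact ⟨0, ∅, by simp [IsAcuteSet], rfl⟩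
  · rintro _ ⟨Z, hZ, rfl⟩
    exact hZ.card_le

/-- For every finite acute set `X ⊆ ℝ^d` there is a finite acute set `Y ⊆ ℝ^{d+2}` with
`|Y| = 2|X|`; consequently `f(d+2) ≥ 2·f(d)`. -/
theorem acute_set_double_dim_plus_two :
    (∀ (d : ℕ) (X : Finset (EuclideanSpace ℝ (Fin d))),
      IsAcuteSet (X : Set (EuclideanSpace ℝ (Fin d))) →
      ∃ Y : Finset (EuclideanSpace ℝ (Fin (d + 2))),
        IsAcuteSet (Y : Set (EuclideanSpace ℝ (Fin (d + 2)))) ∧ Y.card = 2 * X.card) ∧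
    (∀ d : ℕ, 2 * maxAcuteCard d ≤ maxAcuteCard (d + 2)) := by
  refine ⟨fun d X hX => hX.exists_double, fun d => ?_⟩
  obtain ⟨X, hX, hcard⟩ := exists_card_eq_maxAcuteCard d
  obtain ⟨Y, hY, hYcard⟩ := hX.exists_double
  rw [← hcard, ← hYcard]
  exact hY.card_le_maxAcuteCard
end

section
/- For every natural number d there exists a finite acute set in ℝ^d of cardinality at least 2^⌊d/2⌋; in particular, for every k there is an acute set in ℝ^{2k} of cardinality 2^k. -/
open scoped RealInnerProductSpace

/-- All differences seen from any base point of the family have positive pairwise inner products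
(in coordinates); in particular the family is injective. -/
def AcuteFamily {ι : Type*} {n : ℕ} (f : ι → Fin n → ℝ) : Prop :=
  ∀ i j k, i ≠ j → k ≠ j → 0 < ∑ t, (f i t - f j t) * (f k t - f j t)

/-- There is a positive number lying below finitely many given positive numbers. -/
lemma exists_pos_forall_lt {α : Type*} [Finite α] (p : α → Prop) (g : α → ℝ)
    (hg : ∀ a, p a → 0 < g a) : ∃ e : ℝ, 0 < e ∧ ∀ a, p a → e < g a := by
  have h : ∀ᶠ e in nhdsWithin (0 : ℝ) (Set.Ioi 0), ∀ a, p a → e < g a := by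
    refine Filter.eventually_all.2 fun a => ?_
    by_cases ha : p a
    · filter_upwards [Ioo_mem_nhdsGT (hg a ha)] with e he _ using he.2
    · exact Filter.Eventually.of_forall fun e h => absurd h ha
  obtain ⟨e, he, he'⟩ := (h.and self_mem_nhdsWithin).exists
  exact ⟨e, he', he⟩

/-- Finitely many unit vectors of the plane, no two of them parallel. -/
lemma exists_unit_vectors_not_parallel (m : ℕ) : ∃ u v : Fin m → ℝ,
    (∀ i, u i ^ 2 + v i ^ 2 = 1) ∧ ∀ i j, i ≠ j → |u i * u j + v i * v j| < 1 := by
  refine ⟨fun i => Real.cos (1 / ((i : ℝ) + 1)), fun i => Real.sin (1 / ((i : ℝ) + 1)),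
    fun i => Real.cos_sq_add_sin_sq _, fun i j hij => ?_⟩
  have hpos : ∀ i : Fin m, 0 < 1 / ((i : ℝ) + 1) := fun i => by positivity
  have hle : ∀ i : Fin m, 1 / ((i : ℝ) + 1) ≤ 1 := fun i => by
    rw [div_le_one (by positivity)]
    linarith [(Nat.cast_nonneg i.val : (0 : ℝ) ≤ (i.val : ℝ))]
  have hne : 1 / ((i : ℝ) + 1) - 1 / ((j : ℝ) + 1) ≠ 0 := by
    intro h
    apply hij
    have h' := sub_eq_zero.1 h
    rw [one_div, one_div, inv_inj, add_left_inj, Nat.cast_inj] at h'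
    exact Fin.ext h'
  have hpi := Real.pi_gt_three
  have hi := hpos i
  have hj := hpos j
  have hi' := hle i
  have hj' := hle j
  rw [← Real.cos_sub]
  have hcos := Real.cos_pos_of_mem_Ioo
    (x := 1 / ((i : ℝ) + 1) - 1 / ((j : ℝ) + 1)) ⟨by linarith, by linarith⟩
  rw [abs_of_pos hcos]
  refine (Real.cos_le_one _).lt_of_ne fun h => hne ?_
  exact (Real.cos_eq_one_iff_of_lt_of_lt (by linarith) (by linarith)).1 h

/-- Replacing each point of an acute family by a short segment, in pairwise non-parallel directions
of two new dimensions, gives an acute family of twice the size. -/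
lemma AcuteFamily.exists_double {m n : ℕ} {f : Fin m → Fin n → ℝ} (hf : AcuteFamily f) :
    ∃ g : Fin m × Bool → Fin (n + 2) → ℝ, AcuteFamily g := by
  obtain ⟨u, v, huv, hpar⟩ := exists_unit_vectors_not_parallel m
  obtain ⟨e, he, hlt⟩ := exists_pos_forall_lt
    (fun a : Fin m × Fin m × Fin m => a.1 ≠ a.2.1 ∧ a.2.2 ≠ a.2.1)
    (fun a => ∑ t, (f a.1 t - f a.2.1 t) * (f a.2.2 t - f a.2.1 t))
    (fun a ha => hf _ _ _ ha.1 ha.2)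
  obtain ⟨r, hr, hre⟩ : ∃ r : ℝ, 0 < r ∧ 8 * r ^ 2 = e :=
    ⟨√(e / 8), by positivity, by rw [Real.sq_sqrt (by positivity)]; ring⟩
  have hbd : ∀ {x y : ℝ}, x ^ 2 + y ^ 2 = 1 → (-1 ≤ x ∧ x ≤ 1) ∧ -1 ≤ y ∧ y ≤ 1 := by
    intro x y h
    exact ⟨⟨by nlinarith [sq_nonneg y], by nlinarith [sq_nonneg y]⟩,
      by nlinarith [sq_nonneg x], by nlinarith [sq_nonneg x]⟩
  have hprod : ∀ {x y z : ℝ}, -1 ≤ x ∧ x ≤ 1 → -1 ≤ y ∧ y ≤ 1 → -1 ≤ z ∧ z ≤ 1 →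
      -4 ≤ (x - y) * (z - y) := by
    intro x y z hx hy hz
    nlinarith [sq_nonneg (x + z - 2 * y), sq_nonneg (x - z),
      mul_nonneg (by linarith : 0 ≤ 2 - (x - z)) (by linarith : 0 ≤ 2 + (x - z))]
  let sg : Bool → ℝ := fun b => if b then 1 else -1
  have hsg : ∀ b, sg b ^ 2 = 1 := by intro b; cases b <;> simp [sg]
  have hsg' : ∀ {a b}, a ≠ b → sg a = -sg b := by
    intro a b h
    cases a <;> cases b <;> simp_all [sg]
  have hunit : ∀ i a, (sg a * u i) ^ 2 + (sg a * v i) ^ 2 = 1 := by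
    intro i a
    rw [mul_pow, mul_pow, hsg, one_mul, one_mul, huv]
  have hdot : ∀ i a k b, i ≠ k →
      sg a * u i * (sg b * u k) + sg a * v i * (sg b * v k) < 1 := by
    intro i a k b hik
    have h := abs_lt.1 (hpar i k hik)
    cases a <;> cases b <;> simp only [sg] <;> norm_num <;> linarith
  refine ⟨fun p => Fin.cons (r * (sg p.2 * u p.1)) (Fin.cons (r * (sg p.2 * v p.1)) (f p.1)), ?_⟩
  rintro ⟨i, a⟩ ⟨j, s⟩ ⟨k, b⟩ hij hkj
  simp only [Fin.sum_univ_succ, Fin.cons_zero, Fin.cons_succ]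
  have key : ∀ x y z x' y' z' w : ℝ, 0 < w + r ^ 2 * ((x - y) * (z - y) + (x' - y') * (z' - y')) →
      0 < (r * x - r * y) * (r * z - r * y) + ((r * x' - r * y') * (r * z' - r * y') + w) := by
    intro x y z x' y' z' w h
    linarith
  apply key
  have hr2 : 0 < r ^ 2 := by positivity
  by_cases h1 : i = j
  · subst h1
    have ha : sg a = -sg s := hsg' fun h => hij (by rw [h])
    simp only [sub_self, zero_mul, Finset.sum_const_zero, zero_add]
    refine mul_pos hr2 ?_
    have hu := hunit i s
    rw [ha]
    by_cases h2 : k = i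
    · subst h2
      have hb : sg b = -sg s := hsg' fun h => hkj (by rw [h])
      rw [hb]
      nlinarith
    · have := hdot k b i s h2
      nlinarith
  · by_cases h2 : k = j
    · subst h2
      have hb : sg b = -sg s := hsg' fun h => hkj (by rw [h])
      simp only [sub_self, mul_zero, Finset.sum_const_zero, zero_add]
      refine mul_pos hr2 ?_
      have hu := hunit k s
      rw [hb]
      have := hdot i a k s h1
      nlinarith
    · have h := hlt (i, j, k) ⟨h1, h2⟩
      have hA := hbd (hunit i a)
      have hB := hbd (hunit j s)
      have hC := hbd (hunit k b)
      have hx := hprod hA.1 hB.1 hC.1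
      have hy := hprod hA.2 hB.2 hC.2
      simp only at h
      nlinarith [mul_le_mul_of_nonneg_left (add_le_add hx hy) hr2.le]

lemma exists_acuteFamily (d : ℕ) : ∃ f : Fin (2 ^ (d / 2)) → Fin d → ℝ, AcuteFamily f := by
  induction d using Nat.twoStepInduction with
  | zero => exact ⟨fun _ => 0, fun i j _ h => absurd (Subsingleton.elim (α := Fin 1) i j) h⟩
  | one => exact ⟨fun _ => 0, fun i j _ h => absurd (Subsingleton.elim (α := Fin 1) i j) h⟩
  | more d ih _ =>
    obtain ⟨f, hf⟩ := ih
    obtain ⟨g, hg⟩ := hf.exists_double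
    have hcard : Fintype.card (Fin (2 ^ ((d + 2) / 2))) =
        Fintype.card (Fin (2 ^ (d / 2)) × Bool) := by
      simp [pow_succ]
    let φ := Fintype.equivOfCardEq hcard
    exact ⟨g ∘ φ, fun i j k hij hkj => hg _ _ _ (φ.injective.ne hij) (φ.injective.ne hkj)⟩

lemma exists_acute_finset_card_eq (d : ℕ) : ∃ X : Finset (EuclideanSpace ℝ (Fin d)),
    IsAcuteSet (X : Set (EuclideanSpace ℝ (Fin d))) ∧ X.card = 2 ^ (d / 2) := by
  obtain ⟨f, hf⟩ := exists_acuteFamily d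
  let F : Fin (2 ^ (d / 2)) → EuclideanSpace ℝ (Fin d) := fun i => WithLp.toLp 2 (f i)
  have hF : Function.Injective F := by
    intro i j h
    by_contra hij
    have h' : f i = f j := WithLp.toLp_injective 2 h
    have := hf i j i hij hij
    simp [h'] at this
  refine ⟨Finset.univ.map ⟨F, hF⟩, ?_, by simp⟩
  intro a ha b hb c hc hab _ hbc
  simp only [Finset.coe_map, Finset.coe_univ, Set.image_univ, Set.mem_range,
    Function.Embedding.coeFn_mk] at ha hb hc
  obtain ⟨i, rfl⟩ := ha
  obtain ⟨j, rfl⟩ := hb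
  obtain ⟨k, rfl⟩ := hc
  have h := hf i j k (fun h => hab (by rw [h])) (fun h => hbc (by rw [h]))
  rw [EuclideanGeometry.angle, InnerProductGeometry.angle, Real.arccos_lt_pi_div_two]
  have hin : 0 < inner ℝ (F i -ᵥ F j) (F k -ᵥ F j) := by
    simpa [F, PiLp.inner_apply, mul_comm] using h
  refine div_pos hin (mul_pos ?_ ?_) <;> rw [norm_pos_iff, vsub_ne_zero]
  · exact hab
  · exact hbc.symm

/-- For every `d` there is a finite acute set in `ℝ^d` of cardinality at least `2^⌊d/2⌋`;
in particular, for every `k` there is an acute set in `ℝ^{2k}` of cardinality `2^k`. -/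
theorem exists_acute_set_card_two_pow :
    (∀ d : ℕ, ∃ X : Finset (EuclideanSpace ℝ (Fin d)),
      IsAcuteSet (X : Set (EuclideanSpace ℝ (Fin d))) ∧ 2 ^ (d / 2) ≤ X.card) ∧
    (∀ k : ℕ, ∃ X : Finset (EuclideanSpace ℝ (Fin (2 * k))),
      IsAcuteSet (X : Set (EuclideanSpace ℝ (Fin (2 * k)))) ∧ X.card = 2 ^ k) := by
  refine ⟨fun d => ?_, fun k => ?_⟩
  · obtain ⟨X, hX, hcard⟩ := exists_acute_finset_card_eq d
    exact ⟨X, hX, hcard.ge⟩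
  · obtain ⟨X, hX, hcard⟩ := exists_acute_finset_card_eq (2 * k)
    exact ⟨X, hX, by rw [hcard, Nat.mul_div_cancel_left k two_pos]⟩
end

section
/- For every natural number d ≥ 1 there exists a finite acute set in ℝ^d of cardinality F_{d+1}, where F denotes the Fibonacci sequence with F_0 = F_1 = 1 and F_{n+2} = F_{n+1} + F_n. -/
open scoped RealInnerProductSpace

open Filter Topology

section AcuteFamily

variable {V W : Type*} [NormedAddCommGroup V] [InnerProductSpace ℝ V]
  [NormedAddCommGroup W] [InnerProductSpace ℝ W]

/-- A family of points is *acute* if it is injective and all angles it determines are acute: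
taking `a = c` in the definition gives injectivity. -/
def IsAcuteFamily {K : Type*} (f : K → V) : Prop :=
  ∀ a b c, a ≠ b → c ≠ b → 0 < ⟪f a - f b, f c - f b⟫

theorem IsAcuteFamily.injective {K : Type*} {f : K → V} (hf : IsAcuteFamily f) :
    Function.Injective f := by
  intro a b hab
  by_contra h
  simpa [hab] using hf a b a h h

theorem IsAcuteFamily.isAcuteSet_range {K : Type*} {f : K → V} (hf : IsAcuteFamily f) :
    IsAcuteSet (Set.range f) := by
  rintro _ ⟨a, rfl⟩ _ ⟨b, rfl⟩ _ ⟨c, rfl⟩ hab - hbc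
  have h := hf a b c (ne_of_apply_ne f hab) (ne_of_apply_ne f hbc.symm)
  rw [EuclideanGeometry.angle, InnerProductGeometry.angle, Real.arccos_lt_pi_div_two]
  have ha : 0 < ‖f a - f b‖ := norm_pos_iff.2 (sub_ne_zero.2 hab)
  have hc : 0 < ‖f c - f b‖ := norm_pos_iff.2 (sub_ne_zero.2 hbc.symm)
  simp only [vsub_eq_sub]
  positivity

/-- An acute family indexed by `I ⊕ J` whose `I`-part lies in a hyperplane and whose `J`-part
lies strictly on one side of it. -/
structure IsFlaggedAcuteFamily {I J : Type*} (f : I ⊕ J → V) : Prop where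
  acute : IsAcuteFamily f
  exists_hyperplane : ∃ (n : V) (c : ℝ), ‖n‖ = 1 ∧
    (∀ i, ⟪n, f (.inl i)⟫ = c) ∧ ∀ j, c < ⟪n, f (.inr j)⟫

theorem LinearIsometry.inner_add_smul_orthogonal (L : V →ₗᵢ[ℝ] W) {e : W} (he : ‖e‖ = 1)
    (hLe : ∀ v, ⟪L v, e⟫ = 0) (u v : V) (s t : ℝ) :
    ⟪L u + s • e, L v + t • e⟫ = ⟪u, v⟫ + s * t := by
  simp [inner_add_left, inner_add_right, inner_smul_left, inner_smul_right, hLe, he,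
    real_inner_comm (L v) e, mul_comm]

theorem exists_linearIsometry_and_unit_orthogonal (d : ℕ) :
    ∃ (L : EuclideanSpace ℝ (Fin d) →ₗᵢ[ℝ] EuclideanSpace ℝ (Fin (d + 1)))
      (e : EuclideanSpace ℝ (Fin (d + 1))), ‖e‖ = 1 ∧ ∀ v, ⟪L v, e⟫ = 0 := by
  let e : EuclideanSpace ℝ (Fin (d + 1)) := EuclideanSpace.single (Fin.last d) 1
  have he : ‖e‖ = 1 := by simp [e]
  have he0 : e ≠ 0 := by rw [← norm_ne_zero_iff, he]; norm_num
  have : Fact (Module.finrank ℝ (EuclideanSpace ℝ (Fin (d + 1))) = d + 1) := ⟨by simp⟩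
  let φ := (OrthonormalBasis.fromOrthogonalSpanSingleton (𝕜 := ℝ) d he0).repr.symm
  refine ⟨(Submodule.subtypeₗᵢ _).comp φ.toLinearIsometry, e, he, fun v => ?_⟩
  exact Submodule.mem_orthogonal_singleton_iff_inner_left.1 (φ v).2

/-- A finite family of points in a hyperplane is separated by an affine functional whose linear
part is parallel to the hyperplane, and which is positive on finitely many given points. -/
theorem exists_separating_functional [FiniteDimensional ℝ V] {I J : Type*} [Finite I] [Finite J]
    {f : I ⊕ J → V} (hf : Function.Injective f) {n : V} {c : ℝ} (hn : ‖n‖ = 1)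
    (hI : ∀ i, ⟪n, f (.inl i)⟫ = c) :
    ∃ (m : V) (C : ℝ), ⟪m, n⟫ = 0 ∧ (∀ k, 0 < ⟪m, f k⟫ + C) ∧
      ∀ i i', i ≠ i' → ⟪m, f (.inl i)⟫ ≠ ⟪m, f (.inl i')⟫ := by
  obtain ⟨g, hg⟩ := Module.exists_dual_forall_apply_ne_zero (K := ℝ)
    (fun p : {p : I × I // p.1 ≠ p.2} => f (.inl p.1.1) - f (.inl p.1.2))
    (fun p => sub_ne_zero.2 fun h => p.2 (Sum.inl_injective (hf h)))
  let m₀ : V := (InnerProductSpace.toDual ℝ V).symm g.toContinuousLinearMap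
  have hm₀ : ∀ v, ⟪m₀, v⟫ = g v := fun v => by simp [m₀]
  let m : V := m₀ - ⟪m₀, n⟫ • n
  obtain ⟨C, hC⟩ := (Set.finite_range fun k => -⟪m, f k⟫).bddAbove
  refine ⟨m, C + 1, by simp [m, inner_sub_left, inner_smul_left, hn], fun k => ?_,
    fun i i' hii' h => ?_⟩
  · have := hC ⟨k, rfl⟩
    dsimp only at this
    linarith
  · apply hg ⟨(i, i'), hii'⟩
    simp only [m, inner_sub_left, inner_smul_left, hI, hm₀, conj_trivial] at h
    simp only [map_sub]
    linarith

theorem abs_mul_add_mul_lt_of_sq_add_sq_eq {r a b a' b' : ℝ} (h : a ^ 2 + b ^ 2 = r)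
    (h' : a' ^ 2 + b' ^ 2 = r) (ha : 0 < a) (ha' : 0 < a') (hb : 0 ≤ b) (hb' : 0 ≤ b')
    (hne : a ≠ a') : |a * a' + b * b'| < r := by
  rw [abs_of_pos (by positivity)]
  have := sq_pos_of_ne_zero (sub_ne_zero.2 hne)
  nlinarith [sq_nonneg (b - b')]

/-- Splitting every point `f k` of the hyperplane part of a flagged acute family along a vector
`± (β k • n + α k • e)` and lowering the other points `f k` by `α k • e` gives an acute family as
soon as each of the remaining points lies in the slab determined by any of the split pairs. -/
theorem isAcuteFamily_split {I J : Type*} {f : I ⊕ J → V} {n : V} (hn : ‖n‖ = 1)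
    (L : V →ₗᵢ[ℝ] W) {e : W} (he : ‖e‖ = 1) (hLe : ∀ v, ⟪L v, e⟫ = 0)
    {base : (I ⊕ J) ⊕ I → I ⊕ J} (hbase : base = Sum.elim id Sum.inl)
    {b h : (I ⊕ J) ⊕ I → ℝ}
    (hb : ∀ i, b (.inl (.inl i)) = - b (.inr i)) (hh : ∀ i, h (.inl (.inl i)) = - h (.inr i))
    {r : ℝ} (hr : 0 < r) (hbh : ∀ i, h (.inr i) ^ 2 + b (.inr i) ^ 2 = r)
    (hslab : ∀ i w, base w ≠ .inl i →
      |h (.inr i) * h w + b (.inr i) * (⟪n, f (base w)⟫ - ⟪n, f (.inl i)⟫ + b w)| < r)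
    {F : (I ⊕ J) ⊕ I → W} (hF : ∀ w, F w = L (f (base w) + b w • n) + h w • e)
    (hdist : ∀ u v w, base u ≠ base v → base w ≠ base v → 0 < ⟪F u - F v, F w - F v⟫) :
    IsAcuteFamily F := by
  have hnn : ⟪n, n⟫ = 1 := by rw [real_inner_self_eq_norm_sq, hn]; norm_num
  have hsub : ∀ u v, F u - F v = L (f (base u) - f (base v) + (b u - b v) • n)
      + (h u - h v) • e := by
    intro u v
    rw [hF, hF]
    simp only [map_add, map_sub, map_smul, sub_smul]
    abel
  have key : ∀ u v w, u ≠ v → base u = base v → w ≠ v → 0 < ⟪F u - F v, F w - F v⟫ := by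
    intro u v w huv hbuv hwv
    rw [hsub, hsub, L.inner_add_smul_orthogonal he hLe, hbuv, sub_self, zero_add,
      inner_smul_left, inner_add_right, inner_smul_right, hnn, inner_sub_right]
    subst hbase
    rcases u with (i | j) | i <;> rcases v with (i' | j') | i' <;> simp at hbuv huv
    · exact absurd hbuv huv
    · subst hbuv
      by_cases hw : Sum.elim id Sum.inl w = (Sum.inl i : I ⊕ J)
      · rcases w with (k | k) | k <;> simp at hw hwv
        · subst hw
          have := hbh k
          simp [hb, hh]
          nlinarith
        · exact absurd hw hwv
      · have := abs_lt.1 (hslab i w hw)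
        have := hbh i
        simp [hb, hh]
        nlinarith
    · exact absurd hbuv huv
    · subst hbuv
      by_cases hw : Sum.elim id Sum.inl w = (Sum.inl i : I ⊕ J)
      · rcases w with (k | k) | k <;> simp at hw hwv
        · exact absurd hw hwv
        · subst hw
          have := hbh k
          simp [hb, hh]
          nlinarith
      · have := abs_lt.1 (hslab i w hw)
        have := hbh i
        simp [hb, hh]
        nlinarith
    · exact absurd hbuv huv
  intro u v w huv hwv
  by_cases h1 : base u = base v
  · exact key u v w huv h1 hwv
  by_cases h2 : base w = base v
  · rw [real_inner_comm]
    exact key w v u hwv h2 huv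
  exact hdist u v w h1 h2

theorem IsFlaggedAcuteFamily.exists_split [FiniteDimensional ℝ V] {I J : Type*} [Finite I]
    [Finite J] {f : I ⊕ J → V} (hf : IsFlaggedAcuteFamily f) (L : V →ₗᵢ[ℝ] W) {e : W}
    (he : ‖e‖ = 1) (hLe : ∀ v, ⟪L v, e⟫ = 0) :
    ∃ F : (I ⊕ J) ⊕ I → W, IsFlaggedAcuteFamily F := by
  obtain ⟨hacute, n, c, hn, hI, hJ⟩ := hf
  obtain ⟨m, C, hmn, hpos, hsep⟩ := exists_separating_functional hacute.injective hn hI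
  set l : I ⊕ J → ℝ := fun k => ⟪m, f k⟫ + C with hl
  let α : ℝ → I ⊕ J → ℝ := fun ε k => ε - ε ^ 5 * l k
  let β : ℝ → I → ℝ := fun ε i => √(ε ^ 2 - α ε (.inl i) ^ 2)
  let base : (I ⊕ J) ⊕ I → I ⊕ J := Sum.elim id Sum.inl
  let b : ℝ → (I ⊕ J) ⊕ I → ℝ := fun ε =>
    Sum.elim (Sum.elim (fun i => - β ε i) fun _ => 0) (β ε)
  let h : ℝ → (I ⊕ J) ⊕ I → ℝ := fun ε => Sum.elim (fun k => - α ε k) fun i => α ε (.inl i)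
  let F : ℝ → (I ⊕ J) ⊕ I → W := fun ε w => L (f (base w) + b ε w • n) + h ε w • e
  have hFcont : ∀ w, Continuous fun ε => F ε w := by
    intro w
    have hb : Continuous fun ε => b ε w := by
      rcases w with (i | j) | i <;> simp only [b, β, α, Sum.elim_inl, Sum.elim_inr] <;> fun_prop
    have hh : Continuous fun ε => h ε w := by
      rcases w with k | i <;> simp only [h, α, Sum.elim_inl, Sum.elim_inr] <;> fun_prop
    exact (L.continuous.comp (continuous_const.add (hb.smul continuous_const))).add
      (hh.smul continuous_const)
  have hF0 : ∀ w, F 0 w = L (f (base w)) := by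
    rintro ((i | j) | i) <;> simp [F, b, h, β, α, base]
  have e1 : ∀ᶠ ε : ℝ in 𝓝 0, ∀ k, ε ^ 4 * l k < 1 := by
    refine eventually_all.2 fun k => ?_
    have : Continuous fun ε : ℝ => ε ^ 4 * l k := by fun_prop
    exact this.continuousAt.eventually_lt_const (by simp)
  have e2 : ∀ᶠ ε : ℝ in 𝓝 0, ∀ i j,
      2 * ε ^ 2 * l (.inl i) * (⟪n, f (.inr j)⟫ - c) ^ 2 < 1 := by
    refine eventually_all.2 fun i => eventually_all.2 fun j => ?_
    have : Continuous fun ε : ℝ => 2 * ε ^ 2 * l (.inl i) * (⟪n, f (.inr j)⟫ - c) ^ 2 := by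
      fun_prop
    exact this.continuousAt.eventually_lt_const (by simp)
  have e3 : ∀ᶠ ε : ℝ in 𝓝 0, ∀ u v w, base u ≠ base v → base w ≠ base v →
      0 < ⟪F ε u - F ε v, F ε w - F ε v⟫ := by
    refine eventually_all.2 fun u => eventually_all.2 fun v => eventually_all.2 fun w => ?_
    by_cases huw : base u ≠ base v ∧ base w ≠ base v
    · have : Continuous fun ε : ℝ => ⟪F ε u - F ε v, F ε w - F ε v⟫ :=
        ((hFcont u).sub (hFcont v)).inner ((hFcont w).sub (hFcont v))
      have h0 : 0 < ⟪F 0 u - F 0 v, F 0 w - F 0 v⟫ := by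
        simp only [hF0, ← map_sub, L.inner_map_map]
        exact hacute _ _ _ huw.1 huw.2
      filter_upwards [this.continuousAt.eventually_const_lt h0] with ε hε _ _ using hε
    · exact Eventually.of_forall fun ε h1 h2 => absurd ⟨h1, h2⟩ huw
  obtain ⟨ε, ⟨h1, h2, h3⟩, hε : 0 < ε⟩ := (((e1.and (e2.and e3)).filter_mono
    (nhdsWithin_le_nhds (s := Set.Ioi 0))).and self_mem_nhdsWithin).exists
  have hlε : ∀ k, ε ^ 5 * l k < ε := fun k => by nlinarith [h1 k]
  have hlpos : ∀ k, 0 < ε ^ 5 * l k := fun k => mul_pos (by positivity) (hpos k)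
  have hα : ∀ k, 0 < α ε k := fun k => sub_pos.2 (hlε k)
  have hαε : ∀ k, α ε k < ε := fun k => sub_lt_self _ (hlpos k)
  have hβ : ∀ i, 0 ≤ β ε i := fun i => Real.sqrt_nonneg _
  have hβsq : ∀ i, β ε i ^ 2 = ε ^ 2 - α ε (.inl i) ^ 2 := fun i =>
    Real.sq_sqrt (by nlinarith [hα (.inl i), hαε (.inl i)])
  have hα_ne : ∀ i i', i ≠ i' → α ε (.inl i) ≠ α ε (.inl i') := by
    intro i i' hii' heq
    have h5 : ε ^ 5 * l (.inl i) = ε ^ 5 * l (.inl i') := sub_right_injective heq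
    exact hsep i i' hii' (add_right_cancel (mul_left_cancel₀ (by positivity) h5))
  have hpair : ∀ i i', i ≠ i' →
      |α ε (.inl i) * α ε (.inl i') + β ε i * β ε i'| < ε ^ 2 := fun i i' hii' =>
    abs_mul_add_mul_lt_of_sq_add_sq_eq (by rw [hβsq]; ring) (by rw [hβsq]; ring)
      (hα _) (hα _) (hβ _) (hβ _) (hα_ne i i' hii')
  refine ⟨F ε, isAcuteFamily_split hn L he hLe (base := base) rfl (b := b ε) (h := h ε)
    (fun i => rfl) (fun i => rfl) (r := ε ^ 2) (by positivity) ?_ ?_ (fun w => rfl) h3, ?_⟩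
  · intro i
    simp [b, h, hβsq]
  · rintro i ((i' | j) | i') hw
    · have hne : i ≠ i' := fun hii' => hw (by simp [base, hii'])
      have := hpair i i' hne
      rw [← abs_neg] at this
      convert this using 2
      simp [b, h, base, hI]
      ring
    · have hg : 0 < ⟪n, f (.inr j)⟫ - c := sub_pos.2 (hJ j)
      have hβg : β ε i * (⟪n, f (.inr j)⟫ - c) < ε ^ 2 := by
        refine lt_of_pow_lt_pow_left₀ 2 (by positivity) ?_
        have hβle : β ε i ^ 2 ≤ 2 * ε ^ 6 * l (.inl i) := by
          rw [hβsq]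
          simp only [α]
          nlinarith [sq_nonneg (ε ^ 5 * l (.inl i))]
        calc (β ε i * (⟪n, f (.inr j)⟫ - c)) ^ 2
            = β ε i ^ 2 * (⟪n, f (.inr j)⟫ - c) ^ 2 := by ring
          _ ≤ 2 * ε ^ 6 * l (.inl i) * (⟪n, f (.inr j)⟫ - c) ^ 2 := by gcongr
          _ = ε ^ 4 * (2 * ε ^ 2 * l (.inl i) * (⟪n, f (.inr j)⟫ - c) ^ 2) := by ring
          _ < ε ^ 4 * 1 := by gcongr; exact h2 i j
          _ = (ε ^ 2) ^ 2 := by ring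
      have hβg' : 0 ≤ β ε i * (⟪n, f (.inr j)⟫ - c) := mul_nonneg (hβ i) hg.le
      have hαα : 0 < α ε (.inl i) * α ε (.inr j) := mul_pos (hα _) (hα _)
      have hαα' : α ε (.inl i) * α ε (.inr j) < ε ^ 2 := by
        nlinarith [hα (.inl i), hα (.inr j), hαε (.inl i), hαε (.inr j)]
      simp only [b, h, base, Sum.elim_inl, Sum.elim_inr, id, hI, add_zero]
      rw [abs_lt]
      constructor <;> linarith
    · have hne : i ≠ i' := fun hii' => hw (by simp [base, hii'])
      convert hpair i i' hne using 2
      simp [b, h, base, hI]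
  · let N : W := L (-(ε ^ 5) • m) + (1 : ℝ) • e
    have hN : ∀ w, ⟪N, F ε w⟫ = h ε w - ε ^ 5 * (l (base w) - C) := by
      intro w
      simp only [N, F]
      rw [L.inner_add_smul_orthogonal he hLe, inner_smul_left, inner_add_right,
        inner_smul_right, hmn]
      simp [hl]
      ring
    have hN0 : 0 < ‖N‖ := by
      refine norm_pos_iff.2 fun hN0 => ?_
      have := L.inner_add_smul_orthogonal he hLe (-(ε ^ 5) • m) 0 1 1
      rw [show L (-(ε ^ 5) • m) + (1 : ℝ) • e = 0 from hN0] at this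
      simp at this
    refine ⟨‖N‖⁻¹ • N, ‖N‖⁻¹ * (ε ^ 5 * C - ε), ?_, fun k => ?_, fun i => ?_⟩
    · rw [norm_smul, norm_inv, norm_norm, inv_mul_cancel₀ hN0.ne']
    · rw [real_inner_smul_left, hN]
      simp only [h, α, base, Sum.elim_inl, id]
      ring
    · rw [real_inner_smul_left, hN]
      have := hlε (.inl i)
      simp only [h, α, base, Sum.elim_inr]
      exact mul_lt_mul_of_pos_left (by linarith) (inv_pos.2 hN0)

end AcuteFamily

theorem exists_isFlaggedAcuteFamily_card_fib (d : ℕ) :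
    ∃ (I J : Type) (_ : Fintype I) (_ : Fintype J)
      (f : I ⊕ J → EuclideanSpace ℝ (Fin (d + 1))),
      IsFlaggedAcuteFamily f ∧ Fintype.card I = Nat.fib (d + 2) ∧
        Fintype.card J = Nat.fib (d + 1) := by
  induction d with
  | zero =>
    let e : EuclideanSpace ℝ (Fin (0 + 1)) := EuclideanSpace.single 0 1
    have he : ‖e‖ = 1 := by simp [e]
    refine ⟨Unit, Unit, inferInstance, inferInstance, Sum.elim (fun _ => 0) fun _ => e,
      ⟨?_, e, 0, he, by simp, by simp [he]⟩, by simp, by simp⟩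
    rintro (a | a) (b | b) (c | c) <;> simp [he]
  | succ d ih =>
    obtain ⟨I, J, _, _, f, hf, hI, hJ⟩ := ih
    obtain ⟨L, e, he, hLe⟩ := exists_linearIsometry_and_unit_orthogonal (d + 1)
    obtain ⟨F, hF⟩ := hf.exists_split L he hLe
    refine ⟨I ⊕ J, I, inferInstance, inferInstance, F, hF, ?_, hI⟩
    rw [Fintype.card_sum, hI, hJ, Nat.fib_add_two (n := d + 1), add_comm]

/-- For every `d ≥ 1` there is a finite acute set in `ℝ^d` of cardinality `F_{d+1}`, where
`F_0 = F_1 = 1` and `F_{n+2} = F_{n+1} + F_n`, i.e. `F_n = Nat.fib (n+1)`. -/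
theorem exists_acute_set_card_fib (d : ℕ) (hd : 1 ≤ d) :
    ∃ X : Finset (EuclideanSpace ℝ (Fin d)),
      IsAcuteSet (X : Set (EuclideanSpace ℝ (Fin d))) ∧ X.card = Nat.fib (d + 2) := by
  obtain ⟨d, rfl⟩ := Nat.exists_eq_add_of_le' hd
  obtain ⟨I, J, _, _, f, hf, hI, hJ⟩ := exists_isFlaggedAcuteFamily_card_fib d
  refine ⟨Finset.univ.map ⟨f, hf.acute.injective⟩, ?_, ?_⟩
  · simpa using hf.acute.isAcuteSet_range
  · rw [Finset.card_map, Finset.card_univ, Fintype.card_sum, hI, hJ,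
      Nat.fib_add_two (n := d + 1), add_comm]
end

section
/- For every natural number d there exists a finite acute set in ℝ^d of cardinality at least ((1+√5)/2)^d. -/
open scoped RealInnerProductSpace

namespace AcuteSet

open Filter Topology

/-- The point of `ℝ^(n+1)` whose first coordinate is `h` and whose other coordinates are
those of `t • s`. -/
noncomputable def liftPoint {n : ℕ} (t h : ℝ) (s : Fin n → ℝ) : EuclideanSpace ℝ (Fin (n + 1)) :=
  WithLp.toLp 2 (Fin.cons h (t • s))

lemma inner_liftPoint_sub {n : ℕ} (t₁ t₂ t₃ h₁ h₂ h₃ : ℝ) (s₁ s₂ s₃ : Fin n → ℝ) :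
    ⟪liftPoint t₁ h₁ s₁ - liftPoint t₂ h₂ s₂, liftPoint t₃ h₃ s₃ - liftPoint t₂ h₂ s₂⟫ =
      t₁ * t₃ * (s₁ ⬝ᵥ s₃) - t₁ * t₂ * (s₁ ⬝ᵥ s₂) - t₂ * t₃ * (s₂ ⬝ᵥ s₃)
        + t₂ ^ 2 * (s₂ ⬝ᵥ s₂) + (h₁ - h₂) * (h₃ - h₂) := by
  simp only [liftPoint, PiLp.inner_apply, Fin.sum_univ_succ, dotProduct, Finset.mul_sum,
    PiLp.sub_apply, Fin.cons_zero, Fin.cons_succ, Pi.smul_apply, smul_eq_mul,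
    RCLike.inner_apply, conj_trivial]
  rw [← Finset.sum_sub_distrib, ← Finset.sum_sub_distrib, ← Finset.sum_add_distrib, add_comm]
  congr 1
  · exact Finset.sum_congr rfl fun i _ => by ring
  · ring

lemma angle_lt_pi_div_two_of_inner_pos {V : Type*} [NormedAddCommGroup V] [InnerProductSpace ℝ V]
    {a b c : V} (h : 0 < ⟪a - b, c - b⟫) : EuclideanGeometry.angle a b c < Real.pi / 2 := by
  unfold EuclideanGeometry.angle InnerProductGeometry.angle
  rw [Real.arccos_lt_pi_div_two]
  have h₁ : a - b ≠ 0 := fun h₀ => by simp [h₀] at h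
  have h₂ : c - b ≠ 0 := fun h₀ => by simp [h₀] at h
  have := norm_pos_iff.2 h₁
  have := norm_pos_iff.2 h₂
  simp only [vsub_eq_sub]
  positivity

/-- A vertex of the cube `{-1, 1}^n`, as a real vector. -/
def signVec {n : ℕ} (x : Fin n → ℤˣ) : Fin n → ℝ := fun i => ((x i : ℤ) : ℝ)

lemma signVec_eq_or {n : ℕ} (x : Fin n → ℤˣ) (i : Fin n) :
    signVec x i = 1 ∨ signVec x i = -1 := by
  rcases Int.units_eq_one_or (x i) with h | h <;> simp [signVec, h]

lemma signVec_dot_self {n : ℕ} (x : Fin n → ℤˣ) : signVec x ⬝ᵥ signVec x = n := by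
  have : ∀ i, signVec x i * signVec x i = 1 := fun i => by
    rcases signVec_eq_or x i with h | h <;> simp [h]
  simp [dotProduct, this]

lemma neg_le_signVec_dot {n : ℕ} (x y : Fin n → ℤˣ) : -(n : ℝ) ≤ signVec x ⬝ᵥ signVec y := by
  have : ∑ _i : Fin n, (-1 : ℝ) ≤ signVec x ⬝ᵥ signVec y :=
    Finset.sum_le_sum fun i _ => by
      rcases signVec_eq_or x i with h | h <;> rcases signVec_eq_or y i with h' | h' <;>
        norm_num [h, h']
  simpa using this

lemma signVec_dot_le {n : ℕ} {x y : Fin n → ℤˣ} (hxy : x ≠ y) :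
    signVec x ⬝ᵥ signVec y ≤ n - 2 := by
  obtain ⟨j, hj⟩ := Function.ne_iff.1 hxy
  have key : (2 : ℝ) ≤ ∑ i, (1 - signVec x i * signVec y i) := by
    refine le_trans ?_ (Finset.single_le_sum (fun i _ => ?_) (Finset.mem_univ j))
    · rcases Int.units_eq_one_or (x j) with h | h <;>
        rcases Int.units_eq_one_or (y j) with h' | h' <;>
        first | exact absurd (h.trans h'.symm) hj | norm_num [signVec, h, h']
    · rcases signVec_eq_or x i with h | h <;> rcases signVec_eq_or y i with h' | h' <;>
        norm_num [h, h']
  have : ∑ i, (1 - signVec x i * signVec y i) = n - signVec x ⬝ᵥ signVec y := by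
    simp [dotProduct]
  linarith

/-- Angles in the cube are not obtuse. -/
lemma signVec_dot_nonneg {n : ℕ} (x y z : Fin n → ℤˣ) :
    0 ≤ signVec x ⬝ᵥ signVec z - signVec x ⬝ᵥ signVec y - signVec y ⬝ᵥ signVec z + n := by
  have key : 0 ≤ ∑ i, (signVec x i * signVec z i - signVec x i * signVec y i
      - signVec y i * signVec z i + 1) := Finset.sum_nonneg fun i _ => by
    rcases signVec_eq_or x i with h | h <;> rcases signVec_eq_or y i with h' | h' <;>
      rcases signVec_eq_or z i with h'' | h'' <;> norm_num [h, h', h'']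
  simpa [Finset.sum_add_distrib, Finset.sum_sub_distrib, dotProduct] using key

lemma second_order_pos_of_lt {m M A B C u v : ℝ} (hm : 1 ≤ m) (hM : M = 16 * m)
    (hB : 0 < B) (hC : 0 < C) (hAB : M * B ≤ A) (hBC : M * C ≤ B) (hu : 2 ≤ u) (hv : v ≤ 2 * m) :
    0 < u * (2 / M) * (A ^ 2 - B ^ 2) + v * (2 / M) * (C ^ 2 - B ^ 2) + (A - B) * (C - B) := by
  have hM0 : 0 < M := by linarith
  have hCB : C ≤ B := by nlinarith
  have hBA : B ≤ A := by nlinarith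
  have h₁ : 2 * (A ^ 2 - B ^ 2) ≤ u * (A ^ 2 - B ^ 2) :=
    mul_le_mul_of_nonneg_right hu (by nlinarith)
  have h₂ : 2 * m * (C ^ 2 - B ^ 2) ≤ v * (C ^ 2 - B ^ 2) :=
    mul_le_mul_of_nonpos_right hv (by nlinarith)
  have h₃ : -(A * B) ≤ (A - B) * (C - B) := by nlinarith
  have h₄ : M * (A * B) ≤ A ^ 2 := by nlinarith
  have h₅ : 16 * m * (16 * m) * B ^ 2 ≤ A ^ 2 := by
    have : (M * B) ^ 2 ≤ A ^ 2 := by gcongr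
    rw [hM] at this; linarith
  have h₆ : m * B ^ 2 ≤ m * m * B ^ 2 := by
    have : 0 ≤ m * B ^ 2 := by positivity
    nlinarith
  have h₇ : B ^ 2 ≤ m * B ^ 2 := by nlinarith [sq_nonneg B]
  have hB2 : 0 < B ^ 2 := by positivity
  have hC2 : 0 ≤ m * C ^ 2 := by positivity
  have h₈ : M * -(A * B) ≤ M * ((A - B) * (C - B)) := mul_le_mul_of_nonneg_left h₃ hM0.le
  have : 0 < 2 * (u * (A ^ 2 - B ^ 2)) + 2 * (v * (C ^ 2 - B ^ 2)) + M * ((A - B) * (C - B)) := by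
    nlinarith
  have heq : u * (2 / M) * (A ^ 2 - B ^ 2) + v * (2 / M) * (C ^ 2 - B ^ 2) + (A - B) * (C - B)
      = (2 * (u * (A ^ 2 - B ^ 2)) + 2 * (v * (C ^ 2 - B ^ 2)) + M * ((A - B) * (C - B))) / M := by
    field_simp
  rw [heq]
  positivity

/-- The second order term of the inner product at a right angle of the cube is positive when the
heights `A`, `B`, `C` are far apart. -/
lemma second_order_pos {m M A B C u v : ℝ} (hm : 1 ≤ m) (hM : M = 16 * m)
    (hA : 0 < A) (hB : 0 < B) (hC : 0 < C)
    (hAB : M * B ≤ A ∨ M * A ≤ B) (hCB : M * B ≤ C ∨ M * C ≤ B)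
    (hu : 2 ≤ u) (hu' : u ≤ 2 * m) (hv : 2 ≤ v) (hv' : v ≤ 2 * m) :
    0 < u * (2 / M) * (A ^ 2 - B ^ 2) + v * (2 / M) * (C ^ 2 - B ^ 2) + (A - B) * (C - B) := by
  have hM0 : 0 < M := by linarith
  rcases hAB with hAB | hAB <;> rcases hCB with hCB | hCB
  · have h₁ : B < A := by nlinarith
    have h₂ : B < C := by nlinarith
    have : 0 < A ^ 2 - B ^ 2 := by nlinarith
    have : 0 < C ^ 2 - B ^ 2 := by nlinarith
    have : 0 < (A - B) * (C - B) := mul_pos (by linarith) (by linarith)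
    positivity
  · exact second_order_pos_of_lt hm hM hB hC hAB hCB hu hv'
  · have := second_order_pos_of_lt hm hM hB hA hCB hAB hv hu'
    linarith
  · have h₁ : 16 * A ≤ B := by nlinarith
    have h₂ : 16 * C ≤ B := by nlinarith
    have h₃ : (15 / 16 * B) * (15 / 16 * B) ≤ (B - A) * (B - C) := by
      gcongr <;> linarith
    have bound : ∀ w X : ℝ, 0 ≤ w → w ≤ 2 * m →
        -(B ^ 2 / 4) ≤ w * (2 / M) * (X ^ 2 - B ^ 2) := fun w X hw hw' => by
      have hq : w * (2 / M) ≤ 1 / 4 := by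
        rw [hM, mul_div_assoc', div_le_iff₀ (by positivity)]; linarith
      have hq' : 0 ≤ w * (2 / M) := by positivity
      nlinarith [sq_nonneg B, mul_nonneg hq' (sq_nonneg X)]
    have := bound u A (by linarith) hu'
    have := bound v C (by linarith) hv'
    nlinarith [pow_pos hB 2]

lemma eventually_pos_of_continuous {f : ℝ → ℝ} (hf : Continuous f) (h : 0 < f 0) :
    ∀ᶠ e in 𝓝[>] (0 : ℝ), 0 < f e :=
  (hf.continuousAt.eventually (lt_mem_nhds h)).filter_mono nhdsWithin_le_nhds

lemma eventually_pos_of_right_angle {n c A B C P Q R : ℝ} (hG : R - P - Q + n = 0)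
    (hL : 0 < (n - Q) * c * (A ^ 2 - B ^ 2) + (n - P) * c * (C ^ 2 - B ^ 2) + (A - B) * (C - B)) :
    ∀ᶠ e in 𝓝[>] (0 : ℝ),
      0 < (1 - c * (e * A) ^ 2) * (1 - c * (e * C) ^ 2) * R
        - (1 - c * (e * A) ^ 2) * (1 - c * (e * B) ^ 2) * P
        - (1 - c * (e * B) ^ 2) * (1 - c * (e * C) ^ 2) * Q
        + (1 - c * (e * B) ^ 2) ^ 2 * n + (e * A - e * B) * (e * C - e * B) := by
  have h := eventually_pos_of_continuous (f := fun e =>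
    ((n - Q) * c * (A ^ 2 - B ^ 2) + (n - P) * c * (C ^ 2 - B ^ 2) + (A - B) * (C - B))
      + e ^ 2 * (c ^ 2 * (A ^ 2 * C ^ 2 * R - A ^ 2 * B ^ 2 * P - B ^ 2 * C ^ 2 * Q + B ^ 4 * n)))
    (by fun_prop) (by simpa using hL)
  filter_upwards [h, self_mem_nhdsWithin] with e he he0
  have he0 : 0 < e := he0
  have := mul_pos (pow_pos he0 2) he
  obtain rfl : R = P + Q - n := by linarith
  refine this.trans_eq ?_
  ring

/-- Heights of the vertices of the cube, forming a geometric progression. -/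
noncomputable def height {n : ℕ} (x : Fin n → ℤˣ) : ℝ :=
  (16 * ((n : ℝ) + 1)) ^ (Fintype.equivFin (Fin n → ℤˣ) x : ℕ)

lemma height_pos {n : ℕ} (x : Fin n → ℤˣ) : 0 < height x := by
  unfold height; positivity

lemma height_separated {n : ℕ} {x y : Fin n → ℤˣ} (hxy : x ≠ y) :
    16 * ((n : ℝ) + 1) * height y ≤ height x ∨ 16 * ((n : ℝ) + 1) * height x ≤ height y := by
  have hM : (1 : ℝ) ≤ 16 * ((n : ℝ) + 1) := by
    have : (0 : ℝ) ≤ n := n.cast_nonneg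
    linarith
  have hne : (Fintype.equivFin (Fin n → ℤˣ) x : ℕ) ≠ Fintype.equivFin (Fin n → ℤˣ) y :=
    fun h => hxy ((Fintype.equivFin _).injective (Fin.ext h))
  unfold height
  rw [← pow_succ', ← pow_succ']
  rcases lt_or_gt_of_ne hne with h | h
  · exact Or.inr (pow_le_pow_right₀ hM h)
  · exact Or.inl (pow_le_pow_right₀ hM h)

lemma height_injective {n : ℕ} {x y : Fin n → ℤˣ} (hxy : x ≠ y) : height x ≠ height y := by
  have : (0 : ℝ) ≤ n := n.cast_nonneg
  have := height_pos x
  have := height_pos y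
  rcases height_separated hxy with h | h <;> intro h' <;> nlinarith

/-- The perturbed vertices of the cube, together with an apex (the value at `none`). -/
noncomputable def acutePoint (n : ℕ) (e : ℝ) : Option (Fin n → ℤˣ) → EuclideanSpace ℝ (Fin (n + 1))
  | none => liftPoint 0 (n + 1) 0
  | some x => liftPoint (1 - 2 / (16 * ((n : ℝ) + 1)) * (e * height x) ^ 2) (e * height x)
      (signVec x)

lemma eventually_acutePoint_inner_pos {n : ℕ} {a b c : Option (Fin n → ℤˣ)}
    (hab : a ≠ b) (hac : a ≠ c) (hbc : b ≠ c) :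
    ∀ᶠ e in 𝓝[>] (0 : ℝ),
      0 < ⟪acutePoint n e a - acutePoint n e b, acutePoint n e c - acutePoint n e b⟫ := by
  have hn : (0 : ℝ) ≤ n := n.cast_nonneg
  rcases a with _ | a <;> rcases b with _ | b <;> rcases c with _ | c <;>
    simp only [ne_eq, not_true_eq_false, Option.some.injEq] at hab hac hbc <;>
    simp only [acutePoint, inner_liftPoint_sub, signVec_dot_self]
  · refine eventually_pos_of_continuous (by fun_prop) ?_
    have := signVec_dot_le hbc
    simp
    linarith
  · refine eventually_pos_of_continuous (by fun_prop) ?_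
    have := neg_le_signVec_dot a c
    simp
    nlinarith
  · refine eventually_pos_of_continuous (by fun_prop) ?_
    have := signVec_dot_le hab
    simp
    linarith
  · have hG := signVec_dot_nonneg a b c
    rcases hG.lt_or_eq with hG | hG
    · refine eventually_pos_of_continuous (by fun_prop) ?_
      simpa using hG
    · have := signVec_dot_le hab
      have := signVec_dot_le hbc
      have := neg_le_signVec_dot a b
      have := neg_le_signVec_dot b c
      exact eventually_pos_of_right_angle hG.symm
        (second_order_pos (m := n + 1) (by linarith) rfl (height_pos a) (height_pos b)
          (height_pos c) (height_separated hab) (height_separated (Ne.symm hbc))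
          (by linarith) (by linarith) (by linarith) (by linarith))

lemma eventually_acutePoint_ne {n : ℕ} {a b : Option (Fin n → ℤˣ)} (hab : a ≠ b) :
    ∀ᶠ e in 𝓝[>] (0 : ℝ), acutePoint n e a ≠ acutePoint n e b := by
  have apex : ∀ x : Fin n → ℤˣ, ∀ᶠ e in 𝓝[>] (0 : ℝ), acutePoint n e (some x) ≠ acutePoint n e none := by
    intro x
    filter_upwards [eventually_pos_of_continuous (f := fun e => (n + 1 : ℝ) - e * height x)
      (by fun_prop) (by simp; positivity)] with e he h
    have := congrArg (fun p => p 0) h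
    simp only [acutePoint, liftPoint, Fin.cons_zero] at this
    linarith
  rcases a with _ | a <;> rcases b with _ | b
  · exact absurd rfl hab
  · exact (apex b).mono fun e he => he.symm
  · exact apex a
  · filter_upwards [self_mem_nhdsWithin] with e he h
    have he : 0 < e := he
    have := congrArg (fun p => p 0) h
    simp only [acutePoint, liftPoint, Fin.cons_zero] at this
    exact height_injective (fun h => hab (congrArg some h)) (mul_left_cancel₀ he.ne' this)

/-- There is an acute set of `2^n + 1` points in `ℝ^(n+1)`. -/
theorem exists_acute_set_card_two_pow_add_one (n : ℕ) :
    ∃ X : Finset (EuclideanSpace ℝ (Fin (n + 1))),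
      IsAcuteSet (X : Set (EuclideanSpace ℝ (Fin (n + 1)))) ∧ X.card = 2 ^ n + 1 := by
  have h₁ : ∀ᶠ e in 𝓝[>] (0 : ℝ), ∀ a b c : Option (Fin n → ℤˣ), a ≠ b → a ≠ c → b ≠ c →
      0 < ⟪acutePoint n e a - acutePoint n e b, acutePoint n e c - acutePoint n e b⟫ := by
    simp only [eventually_all]
    exact fun a b c => eventually_acutePoint_inner_pos
  have h₂ : ∀ᶠ e in 𝓝[>] (0 : ℝ), ∀ a b : Option (Fin n → ℤˣ), a ≠ b →
      acutePoint n e a ≠ acutePoint n e b := by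
    simp only [eventually_all]
    exact fun a b => eventually_acutePoint_ne
  obtain ⟨e, he₁, he₂⟩ := (h₁.and h₂).exists
  have hinj : Function.Injective (acutePoint n e) := fun a b h => by
    by_contra hab
    exact he₂ a b hab h
  refine ⟨Finset.univ.map ⟨acutePoint n e, hinj⟩, ?_, by simp⟩
  intro a ha b hb c hc hab hac hbc
  simp only [Finset.coe_map, Function.Embedding.coeFn_mk, Finset.coe_univ, Set.image_univ,
    Set.mem_range] at ha hb hc
  obtain ⟨a, rfl⟩ := ha
  obtain ⟨b, rfl⟩ := hb
  obtain ⟨c, rfl⟩ := hc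
  exact angle_lt_pi_div_two_of_inner_pos
    (he₁ a b c (ne_of_apply_ne _ hab) (ne_of_apply_ne _ hac) (ne_of_apply_ne _ hbc))

lemma golden_pow_succ_le (n : ℕ) : ((1 + Real.sqrt 5) / 2) ^ (n + 1) ≤ (2 : ℝ) ^ n + 1 := by
  have hs : Real.sqrt 5 ≤ 9 / 4 := Real.sqrt_le_iff.2 (by norm_num)
  have hs0 : 0 ≤ Real.sqrt 5 := Real.sqrt_nonneg 5
  refine (pow_le_pow_left₀ (by positivity) (by linarith : _ ≤ (13 / 8 : ℝ)) _).trans ?_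
  rcases lt_or_ge n 3 with hn | hn
  · interval_cases n <;> norm_num
  · suffices (13 / 8 : ℝ) ^ (n + 1) ≤ 2 ^ n by linarith
    induction n, hn using Nat.le_induction with
    | base => norm_num
    | succ k _ ih =>
      rw [pow_succ, pow_succ (2 : ℝ)]
      exact mul_le_mul ih (by norm_num) (by norm_num) (by positivity)

end AcuteSet

/-- For every `d` there is a finite acute set in `ℝ^d` of cardinality at least
`((1 + √5)/2)^d`. -/
theorem exists_acute_set_card_golden_pow (d : ℕ) :
    ∃ X : Finset (EuclideanSpace ℝ (Fin d)),
      IsAcuteSet (X : Set (EuclideanSpace ℝ (Fin d))) ∧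
      ((1 + Real.sqrt 5) / 2) ^ d ≤ (X.card : ℝ) := by
  rcases d with _ | n
  · refine ⟨{0}, fun a _ b _ c _ hab => absurd (Subsingleton.elim a b) hab, by simp⟩
  · obtain ⟨X, hX, hcard⟩ := AcuteSet.exists_acute_set_card_two_pow_add_one n
    refine ⟨X, hX, ?_⟩
    rw [hcard]
    exact_mod_cast AcuteSet.golden_pow_succ_le n
end

section
/- For every d ≥ 1 there exist a finite acute set X ⊆ ℝ^d, a nonzero vector u ∈ ℝ^d, and a real number c such that: |X| = F_{d+1}; the number of points x ∈ X with ⟨x,u⟩ = c equals F_d; and ⟨x,u⟩ ≤ c for every x ∈ X (i.e., X lies on one closed side of the hyperplane {x : ⟨x,u⟩ = c}, which contains exactly F_d points of X). -/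
open scoped RealInnerProductSpace

open Filter Topology

theorem EuclideanGeometry.angle_lt_pi_div_two_iff {V : Type*} [NormedAddCommGroup V]
    [InnerProductSpace ℝ V] {a b c : V} :
    EuclideanGeometry.angle a b c < Real.pi / 2 ↔ 0 < ⟪a - b, c - b⟫ := by
  rw [EuclideanGeometry.angle, vsub_eq_sub, vsub_eq_sub,
    InnerProductGeometry.angle, Real.arccos_lt_pi_div_two]
  refine ⟨fun h => ?_, fun h => ?_⟩
  · exact (div_pos_iff_of_pos_right
      (lt_of_le_of_ne (by positivity) fun h0 => by simp [← h0] at h)).1 h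
  · have h1 : a - b ≠ 0 := fun h0 => by simp [h0] at h
    have h2 : c - b ≠ 0 := fun h0 => by simp [h0] at h
    positivity

/-- An acute set `X` lying on one side of a hyperplane, together with a copy of its points in that
hyperplane moved up by one dimension, can be perturbed so that the union is acute; the last
coordinate is recorded separately as `t`. -/
theorem exists_perturbed_prism {V : Type*} [NormedAddCommGroup V] [InnerProductSpace ℝ V]
    (X Y : Finset V) (u : V) (c : ℝ) (hu : ‖u‖ = 1)
    (hX : ∀ x ∈ X, ∀ y ∈ X, ∀ z ∈ X, x ≠ y → z ≠ y → 0 < ⟪x - y, z - y⟫)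
    (hc : ∀ x ∈ X, ⟪x, u⟫ ≤ c) (hYX : Y ⊆ X) (hY : ∀ y ∈ Y, ⟪y, u⟫ = c) :
    ∃ (q : V ⊕ V → V) (t : V ⊕ V → ℝ), (∀ x, t (.inl x) = 0) ∧ (∀ y ∈ Y, 0 < t (.inr y)) ∧
      ∀ i ∈ X.disjSum Y, ∀ j ∈ X.disjSum Y, ∀ k ∈ X.disjSum Y, i ≠ j → k ≠ j →
        0 < ⟪q i - q j, q k - q j⟫ + (t i - t j) * (t k - t j) := by
  obtain ⟨f, hf⟩ := Set.countable_iff_exists_injOn.1 Y.countable_toSet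
  have hv : ∀ y, ∃ v : V, y ∈ X → ∀ x ∈ X, x ≠ y → 0 < ⟪v, x - y⟫ := by
    intro y
    by_cases h : ∃ z ∈ X, z ≠ y
    · obtain ⟨z, hz, hzy⟩ := h
      exact ⟨z - y, fun hy x hx hxy => hX z hz y hy x hx hzy hxy⟩
    · push Not at h
      exact ⟨0, fun _ x hx hxy => absurd (h x hx) hxy⟩
  choose v hv using hv
  let θ : V → ℝ × ℝ → ℝ := fun y p => p.1 * (f y + 1)
  let q : ℝ × ℝ → V ⊕ V → V := fun p =>
    Sum.elim id fun y => y - Real.sin (θ y p) • u + p.2 • v y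
  let t : ℝ × ℝ → V ⊕ V → ℝ := fun p => Sum.elim 0 fun y => Real.cos (θ y p)
  have hqc : ∀ i, Continuous fun p => q p i := by
    rintro (x | y) <;> simp only [q, Sum.elim_inl, Sum.elim_inr] <;> fun_prop
  have htc : ∀ i, Continuous fun p => t p i := by
    rintro (x | y) <;> simp only [t, Sum.elim_inl, Sum.elim_inr] <;> fun_prop
  let G : V ⊕ V → V ⊕ V → V ⊕ V → ℝ × ℝ → ℝ := fun i j k p =>
    ⟪q p i - q p j, q p k - q p j⟫ + (t p i - t p j) * (t p k - t p j)
  have hG : ∀ i j k, Continuous (G i j k) := fun i j k => by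
    have := hqc i; have := hqc j; have := hqc k
    have := htc i; have := htc j; have := htc k
    fun_prop
  have hGcomm : ∀ i j k p, G i j k p = G k j i p := fun i j k p => by
    simp only [G, real_inner_comm, mul_comm]
  let l : Filter (ℝ × ℝ) := (𝓝[>] (0 : ℝ)).curry (𝓝[>] 0)
  have hl : l ≤ 𝓝 0 := by
    refine curry_le_prod.trans ?_
    rw [← Prod.mk_zero_zero, nhds_prod_eq]
    exact Filter.prod_mono nhdsWithin_le_nhds nhdsWithin_le_nhds
  have hpos : ∀ {g : ℝ × ℝ → ℝ}, Continuous g → 0 < g 0 → ∀ᶠ p in l, 0 < g p :=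
    fun hg h0 => hl (hg.continuousAt.eventually (lt_mem_nhds h0))
  have hfst : ∀ᶠ p in l, 0 < p.1 := by
    refine eventually_curry_iff.2 ?_
    filter_upwards [self_mem_nhdsWithin] with ε hε
    exact Eventually.of_forall fun _ => hε
  have hsnd : ∀ᶠ p in l, 0 < p.2 := by
    refine eventually_curry_iff.2 (Eventually.of_forall fun _ => ?_)
    exact self_mem_nhdsWithin
  have hcos : ∀ y, ∀ᶠ p in l, 0 < Real.cos (θ y p) := fun y =>
    hpos (by fun_prop) (by simp [θ])
  have hsin : ∀ y, ∀ᶠ p in l, 0 < Real.sin (θ y p) := fun y => by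
    have h : ∀ᶠ p in l, 0 < Real.pi - θ y p := hpos (by fun_prop) (by simp [θ, Real.pi_pos])
    filter_upwards [h, hfst] with p h h1
    exact Real.sin_pos_of_pos_of_lt_pi (by positivity) (by linarith)
  have hbot : ∀ y ∈ Y, ∀ x ∈ X, x ≠ y → ∀ᶠ p in l, 0 < G (.inr y) (.inl y) (.inl x) p := by
    intro y hy x hx hxy
    filter_upwards [hsin y, hsnd] with p hs h2
    have h3 := hv y (hYX hy) x hx hxy
    have h4 : ⟪u, x - y⟫ ≤ 0 := by
      rw [inner_sub_right, real_inner_comm, real_inner_comm y u, hY y hy]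
      linarith [hc x hx]
    have : G (.inr y) (.inl y) (.inl x) p
        = -(Real.sin (θ y p) * ⟪u, x - y⟫) + p.2 * ⟪v y, x - y⟫ := by
      simp only [G, q, t, Sum.elim_inl, Sum.elim_inr, id, Pi.zero_apply]
      rw [show y - Real.sin (θ y p) • u + p.2 • v y - y
        = -(Real.sin (θ y p) • u) + p.2 • v y by abel, inner_add_left, inner_neg_left,
        real_inner_smul_left, real_inner_smul_left]
      ring
    rw [this]
    have := mul_nonpos_of_nonneg_of_nonpos hs.le h4
    have := mul_pos h2 h3
    linarith
  have htop : ∀ y ∈ Y, ∀ z ∈ Y, z ≠ y → ∀ᶠ p in l, 0 < G (.inl y) (.inr y) (.inr z) p := by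
    intro y hy z hz hzy
    have hfy : (f y : ℝ) - f z ≠ 0 := by
      rw [sub_ne_zero]
      exact fun h => hzy (hf hz hy (Nat.cast_injective h).symm)
    have hu2 : ⟪u, u⟫ = 1 := by rw [real_inner_self_eq_norm_sq, hu, one_pow]
    have huy : ⟪u, z - y⟫ = 0 := by
      rw [inner_sub_right, real_inner_comm, real_inner_comm y u, hY y hy, hY z hz, sub_self]
    have h0 : ∀ ε, G (.inl y) (.inr y) (.inr z) (ε, 0) = 1 - Real.cos (ε * (f y - f z)) := by
      intro ε
      simp only [G, q, t, Sum.elim_inl, Sum.elim_inr, id, Pi.zero_apply, zero_smul, add_zero]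
      rw [show ε * ((f y : ℝ) - f z) = θ y (ε, 0) - θ z (ε, 0) by simp only [θ]; ring,
        Real.cos_sub]
      generalize θ y (ε, 0) = a
      generalize θ z (ε, 0) = b
      rw [show y - (y - Real.sin a • u) = Real.sin a • u by abel,
        show z - Real.sin b • u - (y - Real.sin a • u)
          = (z - y) + (Real.sin a - Real.sin b) • u by rw [sub_smul]; abel,
        inner_add_right, real_inner_smul_left, real_inner_smul_left, real_inner_smul_right,
        huy, hu2]
      linear_combination Real.sin_sq_add_cos_sq a
    have hsmall : ∀ᶠ ε in 𝓝[>] (0 : ℝ), |ε * ((f y : ℝ) - f z)| < 2 * Real.pi := by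
      refine nhdsWithin_le_nhds (ContinuousAt.eventually_lt (by fun_prop) (by fun_prop) ?_)
      simp [Real.pi_pos]
    refine eventually_curry_iff.2 ?_
    filter_upwards [hsmall, self_mem_nhdsWithin] with ε hε hε0
    refine nhdsWithin_le_nhds (ContinuousAt.eventually_lt (by fun_prop)
      ((hG _ _ _).comp (Continuous.prodMk_right ε)).continuousAt ?_)
    simp only [h0]
    have hne : Real.cos (ε * ((f y : ℝ) - f z)) ≠ 1 := by
      rw [abs_lt] at hε
      rw [Ne, Real.cos_eq_one_iff_of_lt_of_lt hε.1 hε.2]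
      exact mul_ne_zero (ne_of_gt hε0) hfy
    have := lt_of_le_of_ne (Real.cos_le_one _) hne
    linarith
  let π : V ⊕ V → V := Sum.elim id id
  let τ : V ⊕ V → ℝ := Sum.elim 0 1
  have hq0 : ∀ i, q 0 i = π i := by rintro (x | y) <;> simp [q, π, θ]
  have ht0 : ∀ i, t 0 i = τ i := by rintro (x | y) <;> simp [t, τ, θ]
  have hπX : ∀ i ∈ X.disjSum Y, π i ∈ X := by
    rintro (x | y) hi
    · exact Finset.inl_mem_disjSum.1 hi
    · exact hYX (Finset.inr_mem_disjSum.1 hi)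
  have hG0 : ∀ i j k, G i j k 0 = ⟪π i - π j, π k - π j⟫ + (τ i - τ j) * (τ k - τ j) :=
    fun i j k => by simp only [G, hq0, ht0]
  have hτ : ∀ i j k, 0 ≤ (τ i - τ j) * (τ k - τ j) := by
    rintro (_ | _) (_ | _) (_ | _) <;> simp [τ]
  have hdeg : ∀ i ∈ X.disjSum Y, ∀ j ∈ X.disjSum Y, ∀ k ∈ X.disjSum Y, i ≠ j → k ≠ j →
      π i = π j → ∀ᶠ p in l, 0 < G i j k p := by
    rintro (x | x) hi (y | y) hj k hk hij hkj (rfl : x = y)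
    · exact absurd rfl hij
    · rcases k with z | z
      · refine hpos (hG _ _ _) ?_
        simp [hG0, π, τ]
      · exact htop x (Finset.inr_mem_disjSum.1 hj) z (Finset.inr_mem_disjSum.1 hk)
          fun h => hkj (h ▸ rfl)
    · rcases k with z | z
      · exact hbot x (Finset.inr_mem_disjSum.1 hi) z (Finset.inl_mem_disjSum.1 hk)
          fun h => hkj (h ▸ rfl)
      · refine hpos (hG _ _ _) ?_
        simp [hG0, π, τ]
    · exact absurd rfl hij
  have hall : ∀ i ∈ X.disjSum Y, ∀ j ∈ X.disjSum Y, ∀ k ∈ X.disjSum Y,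
      ∀ᶠ p in l, i ≠ j → k ≠ j → 0 < G i j k p := by
    intro i hi j hj k hk
    by_cases hij : i = j
    · exact Eventually.of_forall fun _ h => absurd hij h
    by_cases hkj : k = j
    · exact Eventually.of_forall fun _ _ h => absurd hkj h
    suffices ∀ᶠ p in l, 0 < G i j k p from this.mono fun _ h _ _ => h
    by_cases h1 : π i = π j
    · exact hdeg i hi j hj k hk hij hkj h1
    by_cases h2 : π k = π j
    · simpa only [hGcomm i j k] using hdeg k hk j hj i hi hkj hij h2
    refine hpos (hG i j k) ?_
    rw [hG0]
    linarith [hX _ (hπX i hi) _ (hπX j hj) _ (hπX k hk) h1 h2, hτ i j k]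
  have hfinal : ∀ᶠ p in l, (∀ y ∈ Y, 0 < t p (.inr y)) ∧
      ∀ i ∈ X.disjSum Y, ∀ j ∈ X.disjSum Y, ∀ k ∈ X.disjSum Y, i ≠ j → k ≠ j → 0 < G i j k p := by
    simp only [eventually_and, eventually_all_finset]
    exact ⟨fun y _ => hcos y, hall⟩
  obtain ⟨ε, hε⟩ := (eventually_curry_iff.1 hfinal).exists
  obtain ⟨δ, h1, h2⟩ := hε.exists
  exact ⟨q (ε, δ), t (ε, δ), fun _ => rfl, h1, h2⟩

theorem EuclideanSpace.inner_toLp_cons_sub {d : ℕ} (a b c : EuclideanSpace ℝ (Fin d))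
    (r s t : ℝ) :
    ⟪(WithLp.toLp 2 (Fin.cons r a.ofLp) - WithLp.toLp 2 (Fin.cons s b.ofLp) :
        EuclideanSpace ℝ (Fin (d + 1))),
      WithLp.toLp 2 (Fin.cons t c.ofLp) - WithLp.toLp 2 (Fin.cons s b.ofLp)⟫
      = ⟪a - b, c - b⟫ + (r - s) * (t - s) := by
  simp only [PiLp.inner_apply, Fin.sum_univ_succ, PiLp.sub_apply, Fin.cons_zero, Fin.cons_succ,
    RCLike.inner_apply, conj_trivial]
  ring

theorem exists_acute_finset_fib (d : ℕ) (hd : 1 ≤ d) :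
    ∃ (X : Finset (EuclideanSpace ℝ (Fin d))) (u : EuclideanSpace ℝ (Fin d)) (c : ℝ),
      ‖u‖ = 1 ∧
      (∀ x ∈ X, ∀ y ∈ X, ∀ z ∈ X, x ≠ y → z ≠ y → 0 < ⟪x - y, z - y⟫) ∧
      X.card = Nat.fib (d + 2) ∧
      (X.filter fun x => ⟪x, u⟫ = c).card = Nat.fib (d + 1) ∧
      ∀ x ∈ X, ⟪x, u⟫ ≤ c := by
  classical
  induction d, hd using Nat.le_induction with
  | base =>
    have hne : (0 : EuclideanSpace ℝ (Fin 1)) ≠ EuclideanSpace.single 0 1 := fun h => by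
      simpa using congrArg (fun v => v 0) h
    refine ⟨{0, EuclideanSpace.single 0 1}, EuclideanSpace.single 0 1, 1, by simp, ?_, ?_, ?_, ?_⟩
    · simp [hne, hne.symm]
    · rw [Finset.card_pair hne]; rfl
    · simp [Finset.filter_insert, Finset.filter_singleton]
    · simp
  | succ d hd ih =>
    obtain ⟨X, u, c, hu, hX, hcard, hcardY, hc⟩ := ih
    set Y := X.filter fun x => ⟪x, u⟫ = c with hYdef
    obtain ⟨q, t, htl, htr, hqt⟩ := exists_perturbed_prism X Y u c hu hX hc
      (Finset.filter_subset _ _) (fun y hy => (Finset.mem_filter.1 hy).2)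
    let g : EuclideanSpace ℝ (Fin d) ⊕ EuclideanSpace ℝ (Fin d) → EuclideanSpace ℝ (Fin (d + 1)) :=
      fun i => WithLp.toLp 2 (Fin.cons (t i) (q i).ofLp)
    have hg : ∀ i ∈ X.disjSum Y, ∀ j ∈ X.disjSum Y, ∀ k ∈ X.disjSum Y, i ≠ j → k ≠ j →
        0 < ⟪g i - g j, g k - g j⟫ := fun i hi j hj k hk hij hkj => by
      rw [EuclideanSpace.inner_toLp_cons_sub]
      exact hqt i hi j hj k hk hij hkj
    have hinj : Set.InjOn g (X.disjSum Y) := fun i hi j hj hij => by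
      by_contra h
      simpa [hij] using hg i hi j hj i hi h h
    have hgu : ∀ i, ⟪g i, EuclideanSpace.single 0 (-1)⟫ = -t i := fun i => by
      rw [EuclideanSpace.inner_single_right]
      simp [g]
    refine ⟨(X.disjSum Y).image g, EuclideanSpace.single 0 (-1), 0, by simp, ?_, ?_, ?_, ?_⟩
    · simp only [Finset.forall_mem_image]
      exact fun i hi j hj k hk hij hkj =>
        hg i hi j hj k hk (fun h => hij (h ▸ rfl)) (fun h => hkj (h ▸ rfl))
    · rw [Finset.card_image_of_injOn hinj, Finset.card_disjSum, hcard, hcardY, add_comm]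
      exact (Nat.fib_add_two).symm
    · have : ((X.disjSum Y).image g).filter (fun x => ⟪x, EuclideanSpace.single 0 (-1)⟫ = 0)
          = (X.map Function.Embedding.inl).image g := by
        rw [Finset.filter_image]
        congr 1
        ext (x | y)
        · simp [hgu, htl]
        · simpa [hgu] using fun hy => (htr y hy).ne'
      rw [this, Finset.card_image_of_injOn, Finset.card_map, hcard]
      refine hinj.mono fun i hi => ?_
      obtain ⟨x, hx, rfl⟩ := Finset.mem_map.1 hi
      exact Finset.inl_mem_disjSum.2 hx
    · simp only [Finset.forall_mem_image, hgu]
      rintro (x | y) hi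
      · simp [htl]
      · simpa using (htr y (Finset.inr_mem_disjSum.1 hi)).le

/-- For every `d ≥ 1` there is a finite acute set `X ⊆ ℝ^d` with `|X| = F_{d+1}` together with
a hyperplane `{x : ⟪x,u⟫ = c}` containing exactly `F_d` points of `X` and such that `X` lies on
one closed side of it.  (Here `F_n = Nat.fib (n+1)`, so `F_0 = F_1 = 1`.) -/
theorem exists_acute_set_fib_with_hyperplane (d : ℕ) (hd : 1 ≤ d) :
    ∃ (X : Finset (EuclideanSpace ℝ (Fin d))) (u : EuclideanSpace ℝ (Fin d)) (c : ℝ),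
      u ≠ 0 ∧
      IsAcuteSet (X : Set (EuclideanSpace ℝ (Fin d))) ∧
      X.card = Nat.fib (d + 2) ∧
      {x : EuclideanSpace ℝ (Fin d) | x ∈ X ∧ ⟪x, u⟫ = c}.ncard = Nat.fib (d + 1) ∧
      ∀ x ∈ X, ⟪x, u⟫ ≤ c := by
  obtain ⟨X, u, c, hu, hX, hcard, hcardY, hc⟩ := exists_acute_finset_fib d hd
  refine ⟨X, u, c, norm_ne_zero_iff.1 (by simp [hu]), ?_, hcard, ?_, hc⟩
  · intro x hx y hy z hz hxy _ hyz
    exact EuclideanGeometry.angle_lt_pi_div_two_iff.2 (hX x hx y hy z hz hxy hyz.symm)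
  · rw [← hcardY, ← Set.ncard_coe_finset, Finset.coe_filter]
end

section
/- Let X ⊆ ℝ^d be a finite acute set with |X| ≥ 2, and let s = min{ ⟨y − x, z − x⟩ : x, y, z ∈ X, y ≠ x, z ≠ x }. Let r > 0 satisfy 4r² < s, and let φ : X → ℝ² be a map with ‖φ(x)‖ = r for every x ∈ X such that the 2|X| points {φ(x) : x ∈ X} ∪ {−φ(x) : x ∈ X} are pairwise distinct. Then the set Y = {(x, φ(x)) : x ∈ X} ∪ {(x, −φ(x)) : x ∈ X} ⊆ ℝ^d × ℝ² = ℝ^{d+2} is an acute set of cardinality 2|X|. -/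
open scoped RealInnerProductSpace

/-- An angle is less than `π/2` when the corresponding inner product is positive. -/
theorem angle_lt_pi_div_two_of_inner_pos {V : Type*} [NormedAddCommGroup V]
    [InnerProductSpace ℝ V] {a b c : V} (h : 0 < ⟪a - b, c - b⟫) :
    EuclideanGeometry.angle a b c < Real.pi / 2 := by
  have ha : a - b ≠ 0 := fun h0 => by simp [h0] at h
  have hc : c - b ≠ 0 := fun h0 => by simp [h0] at h
  simp only [EuclideanGeometry.angle, InnerProductGeometry.angle, vsub_eq_sub,
    Real.arccos_lt_pi_div_two]
  exact div_pos h (mul_pos (norm_pos_iff.mpr ha) (norm_pos_iff.mpr hc))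

/-- Two distinct vectors `v`, `w` of equal norm satisfy `0 < ⟪-v - v, w - v⟫`, this inner
product being `‖w - v‖²`. -/
theorem inner_neg_sub_self_pos {V : Type*} [NormedAddCommGroup V] [InnerProductSpace ℝ V]
    {v w : V} (h : ‖v‖ = ‖w‖) (hne : w ≠ v) : 0 < ⟪-v - v, w - v⟫ := by
  have hp : 0 < ‖w - v‖ := norm_pos_iff.mpr (sub_ne_zero.mpr hne)
  have h1 := norm_sub_sq_real w v
  have h2 : ⟪-v - v, w - v⟫ = 2 * ‖v‖ ^ 2 - 2 * ⟪w, v⟫ := by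
    simp only [inner_sub_left, inner_sub_right, inner_neg_left, real_inner_self_eq_norm_sq,
      real_inner_comm]
    ring
  rw [← h] at h1
  nlinarith

/-- Differences of vectors of norm `r` have inner product at least `-4r²`. -/
theorem neg_four_mul_sq_le_inner_sub_sub {V : Type*} [NormedAddCommGroup V]
    [InnerProductSpace ℝ V] {r : ℝ} {u v w : V} (hu : ‖u‖ = r) (hv : ‖v‖ = r) (hw : ‖w‖ = r) :
    -(4 * r ^ 2) ≤ ⟪u - v, w - v⟫ := by
  have h1 : ‖u - v‖ ≤ 2 * r := (norm_sub_le u v).trans (by linarith)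
  have h2 : ‖w - v‖ ≤ 2 * r := (norm_sub_le w v).trans (by linarith)
  have h3 := (abs_le.mp (abs_real_inner_le_norm (u - v) (w - v))).1
  have h4 := mul_le_mul h1 h2 (norm_nonneg _) ((norm_nonneg _).trans h1)
  linarith

/-- The key fact: if `X ⊆ ℝ^d` is a finite acute set with `|X| ≥ 2`,
`s` is the minimum of the inner products `⟪y - x, z - x⟫` over `x, y, z ∈ X` with `y ≠ x`,
`z ≠ x`, `r > 0` satisfies `4r² < s`, and `φ` assigns to each point of `X` a vector of `ℝ²` of
norm `r` so that the `2|X|` vectors `±φ(x)` are pairwise distinct, then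
`Y = {(x, ±φ(x)) : x ∈ X} ⊆ ℝ^d × ℝ² = ℝ^{d+2}` is an acute set of cardinality `2|X|`. -/
theorem acute_set_prod_circle {d : ℕ}
    (X : Finset (EuclideanSpace ℝ (Fin d)))
    (hX : IsAcuteSet (X : Set (EuclideanSpace ℝ (Fin d))))
    (hcard : 2 ≤ X.card)
    (s : ℝ)
    (hs : IsLeast {t : ℝ | ∃ x ∈ X, ∃ y ∈ X, ∃ z ∈ X, y ≠ x ∧ z ≠ x ∧
      t = ⟪y - x, z - x⟫} s)
    (r : ℝ) (hr : 0 < r) (hrs : 4 * r ^ 2 < s)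
    (φ : EuclideanSpace ℝ (Fin d) → EuclideanSpace ℝ (Fin 2))
    (hφ : ∀ x ∈ X, ‖φ x‖ = r)
    (hinj : ∀ x ∈ X, ∀ y ∈ X, (φ x = φ y → x = y) ∧ φ x ≠ -φ y) :
    IsAcuteSet
      (((fun x => (WithLp.equiv 2 (EuclideanSpace ℝ (Fin d) × EuclideanSpace ℝ (Fin 2))).symm
          (x, φ x)) '' (X : Set (EuclideanSpace ℝ (Fin d)))) ∪
        ((fun x => (WithLp.equiv 2 (EuclideanSpace ℝ (Fin d) × EuclideanSpace ℝ (Fin 2))).symm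
          (x, -φ x)) '' (X : Set (EuclideanSpace ℝ (Fin d))))) ∧
    (((fun x => (WithLp.equiv 2 (EuclideanSpace ℝ (Fin d) × EuclideanSpace ℝ (Fin 2))).symm
          (x, φ x)) '' (X : Set (EuclideanSpace ℝ (Fin d)))) ∪
        ((fun x => (WithLp.equiv 2 (EuclideanSpace ℝ (Fin d) × EuclideanSpace ℝ (Fin 2))).symm
          (x, -φ x)) '' (X : Set (EuclideanSpace ℝ (Fin d))))).ncard = 2 * X.card := by
  set A := fun x => (WithLp.equiv 2 (EuclideanSpace ℝ (Fin d) × EuclideanSpace ℝ (Fin 2))).symm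
    (x, φ x) with hA
  set B := fun x => (WithLp.equiv 2 (EuclideanSpace ℝ (Fin d) × EuclideanSpace ℝ (Fin 2))).symm
    (x, -φ x) with hB
  have hAinj : Function.Injective A := fun x y h => by
    simpa [hA] using congrArg WithLp.fst h
  have hBinj : Function.Injective B := fun x y h => by
    simpa [hB] using congrArg WithLp.fst h
  have hmem : ∀ p ∈ A '' X ∪ B '' X, p.fst ∈ X ∧ (p.snd = φ p.fst ∨ p.snd = -φ p.fst) := by
    rintro p (⟨x, hx, rfl⟩ | ⟨x, hx, rfl⟩)
    · exact ⟨hx, Or.inl rfl⟩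
    · exact ⟨hx, Or.inr rfl⟩
  have hnorm : ∀ p ∈ A '' X ∪ B '' X, ‖p.snd‖ = r := fun p hp => by
    obtain ⟨h, h' | h'⟩ := hmem p hp <;> simp [h', hφ _ h]
  have hext : ∀ p q : WithLp 2 (EuclideanSpace ℝ (Fin d) × EuclideanSpace ℝ (Fin 2)),
      p.fst = q.fst → p.snd = q.snd → p = q := fun p q h h' =>
    WithLp.ofLp_injective 2 (Prod.ext h h')
  have hsnd : ∀ p ∈ A '' X ∪ B '' X, ∀ q ∈ A '' X ∪ B '' X, p.snd = q.snd → p.fst = q.fst := by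
    intro p hp q hq h
    obtain ⟨hpX, hp⟩ := hmem p hp
    obtain ⟨hqX, hq⟩ := hmem q hq
    have h1 := hinj _ hpX _ hqX
    have h2 := hinj _ hqX _ hpX
    rcases hp with hp | hp <;> rcases hq with hq | hq <;> rw [hp, hq] at h
    · exact h1.1 h
    · exact absurd h h1.2
    · exact absurd h.symm h2.2
    · exact h1.1 (neg_injective h)
  have hneg : ∀ p ∈ A '' X ∪ B '' X, ∀ q ∈ A '' X ∪ B '' X, p ≠ q → p.fst = q.fst →
      p.snd = -q.snd := by
    intro p hp q hq hne h
    have hne' : p.snd ≠ q.snd := fun h' => hne (hext p q h h')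
    obtain ⟨-, hp⟩ := hmem p hp
    obtain ⟨-, hq⟩ := hmem q hq
    rw [h] at hp
    rcases hp with hp | hp <;> rcases hq with hq | hq
    · exact absurd (hp.trans hq.symm) hne'
    · rw [hp, hq, neg_neg]
    · rw [hp, hq]
    · exact absurd (hp.trans hq.symm) hne'
  have hantipodal : ∀ a ∈ A '' X ∪ B '' X, ∀ b ∈ A '' X ∪ B '' X, ∀ c ∈ A '' X ∪ B '' X,
      a ≠ b → b ≠ c → a.fst = b.fst → 0 < ⟪a - b, c - b⟫ := by
    intro a ha b hb c hc hab hbc h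
    have hcb : c.snd ≠ b.snd := fun h' => hbc (hext c b (hsnd c hc b hb h') h').symm
    have hpos := inner_neg_sub_self_pos ((hnorm b hb).trans (hnorm c hc).symm) hcb
    rw [WithLp.prod_inner_apply]
    change 0 < ⟪a.fst - b.fst, c.fst - b.fst⟫ + ⟪a.snd - b.snd, c.snd - b.snd⟫
    rw [h, hneg a ha b hb hab h, sub_self, inner_zero_left, zero_add]
    exact hpos
  refine ⟨fun a ha b hb c hc hab _ hbc => angle_lt_pi_div_two_of_inner_pos ?_, ?_⟩
  · by_cases h1 : a.fst = b.fst
    · exact hantipodal a ha b hb c hc hab hbc h1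
    by_cases h2 : c.fst = b.fst
    · rw [real_inner_comm]
      exact hantipodal c hc b hb a ha hbc.symm hab.symm h2
    have hle := hs.2 ⟨_, (hmem b hb).1, _, (hmem a ha).1, _, (hmem c hc).1, h1, h2, rfl⟩
    have hge := neg_four_mul_sq_le_inner_sub_sub (hnorm a ha) (hnorm b hb) (hnorm c hc)
    rw [WithLp.prod_inner_apply]
    change 0 < ⟪a.fst - b.fst, c.fst - b.fst⟫ + ⟪a.snd - b.snd, c.snd - b.snd⟫
    linarith
  · have hdisj : Disjoint (A '' X) (B '' X) := by
      rw [Set.disjoint_left]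
      rintro _ ⟨x, hx, rfl⟩ ⟨y, hy, h⟩
      exact (hinj x hx y hy).2 (congrArg WithLp.snd h).symm
    rw [Set.ncard_union_eq hdisj (X.finite_toSet.image A) (X.finite_toSet.image B),
      Set.ncard_image_of_injective _ hAinj, Set.ncard_image_of_injective _ hBinj,
      Set.ncard_coe_finset, two_mul]
end

section
/- Let d ≥ 1 and let X ⊆ ℝ^{d+1} be a finite acute set such that every x ∈ X has last coordinate x_{d+1} = 0 and d-th coordinate x_d ≥ 0. Let A = {x ∈ X : x_d = 0}, B = X \ A, and let m > 0 satisfy x_d < m for all x ∈ X. For r > 0 let H_r = {x ∈ ℝ^{d+1} : r·x_d + m·x_{d+1} = r·m} (the hyperplane through {x : x_d = m, x_{d+1} = 0} and {x : x_d = 0, x_{d+1} = r}), let A₊ = {a + r·e_{d+1} : a ∈ A}, A₋ = {a − r·e_{d+1} : a ∈ A}, and let B_H be the image of B under the orthogonal projection onto H_r. Then there exists r₀ > 0 such that for all 0 < r < r₀: any three pairwise distinct points x, y, z ∈ A₊ ∪ A₋ ∪ B_H that are not all contained in A₊ ∪ A₋ form an acute triangle (all three angles are strictly less than π/2). -/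
open scoped RealInnerProductSpace

/-- The index of the `d`-th coordinate (1-based) of `ℝ^{d+1}`, i.e. the second-to-last
coordinate when `d ≥ 1`. -/
def dIdx (d : ℕ) : Fin (d + 1) := ⟨d - 1, Nat.lt_succ_of_le (Nat.sub_le d 1)⟩

/-- The index of the `(d+1)`-st (last) coordinate of `ℝ^{d+1}`. -/
def lastIdx (d : ℕ) : Fin (d + 1) := Fin.last d

/-- The last standard basis vector `e_{d+1}` of `ℝ^{d+1}`. -/
noncomputable def eLast (d : ℕ) : EuclideanSpace ℝ (Fin (d + 1)) :=
  EuclideanSpace.single (lastIdx d) 1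

/-- The orthogonal projection of `v` onto the hyperplane `{x : ⟪x, u⟫ = c}` (for `u ≠ 0`). -/
noncomputable def projHyp {n : ℕ} (u : EuclideanSpace ℝ (Fin n)) (c : ℝ)
    (v : EuclideanSpace ℝ (Fin n)) : EuclideanSpace ℝ (Fin n) :=
  v - ((⟪v, u⟫ - c) / ‖u‖ ^ 2) • u

/-- `A = {x ∈ X : x_d = 0}`. -/
def Aset (d : ℕ) (X : Finset (EuclideanSpace ℝ (Fin (d + 1)))) :
    Set (EuclideanSpace ℝ (Fin (d + 1))) :=
  {x | x ∈ X ∧ x (dIdx d) = 0}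

/-- `B = X \ A`. -/
def Bset (d : ℕ) (X : Finset (EuclideanSpace ℝ (Fin (d + 1)))) :
    Set (EuclideanSpace ℝ (Fin (d + 1))) :=
  (X : Set (EuclideanSpace ℝ (Fin (d + 1)))) \ Aset d X

/-- The normal vector `r·e_d + m·e_{d+1}` of the hyperplane
`H_r = {x : r·x_d + m·x_{d+1} = r·m}`. -/
noncomputable def normalHr (d : ℕ) (r m : ℝ) : EuclideanSpace ℝ (Fin (d + 1)) :=
  r • EuclideanSpace.single (dIdx d) 1 + m • eLast d

/-- `A₊ = A + r·e_{d+1}`. -/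
noncomputable def Aplus (d : ℕ) (X : Finset (EuclideanSpace ℝ (Fin (d + 1)))) (r : ℝ) :
    Set (EuclideanSpace ℝ (Fin (d + 1))) :=
  (fun a => a + r • eLast d) '' Aset d X

/-- `A₋ = A − r·e_{d+1}`. -/
noncomputable def Aminus (d : ℕ) (X : Finset (EuclideanSpace ℝ (Fin (d + 1)))) (r : ℝ) :
    Set (EuclideanSpace ℝ (Fin (d + 1))) :=
  (fun a => a - r • eLast d) '' Aset d X

/-- `B_H`, the orthogonal projection of `B` onto the hyperplane
`H_r = {x : r·x_d + m·x_{d+1} = r·m}`. -/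
noncomputable def BHset (d : ℕ) (X : Finset (EuclideanSpace ℝ (Fin (d + 1)))) (r m : ℝ) :
    Set (EuclideanSpace ℝ (Fin (d + 1))) :=
  projHyp (normalHr d r m) (r * m) '' Bset d X

open Filter Topology

/-- An angle is acute iff the inner product of the edge vectors at its vertex is positive. -/
theorem angle_lt_pi_div_two_iff_inner_pos {V : Type*} [NormedAddCommGroup V]
    [InnerProductSpace ℝ V] (a b c : V) :
    EuclideanGeometry.angle a b c < Real.pi / 2 ↔ 0 < ⟪a - b, c - b⟫ := by
  rw [EuclideanGeometry.angle, InnerProductGeometry.angle, Real.arccos_lt_pi_div_two,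
    vsub_eq_sub, vsub_eq_sub]
  constructor
  · intro h
    by_contra hn
    exact absurd h (not_lt.mpr (div_nonpos_of_nonpos_of_nonneg (not_lt.mp hn) (by positivity)))
  · intro h
    have h₁ : a - b ≠ 0 := by rintro h₀; simp [h₀] at h
    have h₂ : c - b ≠ 0 := by rintro h₀; simp [h₀] at h
    have := norm_pos_iff.mpr h₁
    have := norm_pos_iff.mpr h₂
    positivity

theorem IsAcuteSet.inner_pos {V : Type*} [NormedAddCommGroup V] [InnerProductSpace ℝ V]
    {S : Set V} (hS : IsAcuteSet S) {a b c : V} (ha : a ∈ S) (hb : b ∈ S) (hc : c ∈ S)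
    (hab : a ≠ b) (hcb : c ≠ b) : 0 < ⟪a - b, c - b⟫ := by
  by_cases hac : a = c
  · subst hac
    exact real_inner_self_pos.mpr (sub_ne_zero.mpr hab)
  · exact (angle_lt_pi_div_two_iff_inner_pos a b c).mp (hS a ha b hb c hc hab hac hcb.symm)

/-- Finitely many small perturbations of the points of a finite acute set keep all angles with
distinct unperturbed endpoints and vertex acute. -/
theorem IsAcuteSet.eventually_inner_pos {V ι α : Type*} [NormedAddCommGroup V]
    [InnerProductSpace ℝ V] [Finite ι] {l : Filter α} {X : Finset V}
    (hX : IsAcuteSet (X : Set V)) {q : ι → V → α → V}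
    (hq : ∀ i, ∀ v ∈ X, Tendsto (q i v) l (𝓝 v)) :
    ∀ᶠ r in l, ∀ i j k, ∀ a ∈ X, ∀ b ∈ X, ∀ c ∈ X, a ≠ b → c ≠ b →
      0 < ⟪q i a r - q j b r, q k c r - q j b r⟫ := by
  simp only [eventually_all, Finset.eventually_all]
  intro i j k a ha b hb c hc hab hcb
  exact (((hq i a ha).sub (hq j b hb)).inner ((hq k c hc).sub (hq j b hb))).eventually_const_lt
    (hX.inner_pos ha hb hc hab hcb)

theorem inner_projHyp {n : ℕ} {u : EuclideanSpace ℝ (Fin n)} (hu : u ≠ 0) (c : ℝ)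
    (v : EuclideanSpace ℝ (Fin n)) : ⟪projHyp u c v, u⟫ = c := by
  have : ‖u‖ ≠ 0 := norm_ne_zero_iff.mpr hu
  rw [projHyp, inner_sub_left, real_inner_smul_left, real_inner_self_eq_norm_sq]
  field_simp
  ring

theorem dIdx_ne_lastIdx {d : ℕ} (hd : 1 ≤ d) : dIdx d ≠ lastIdx d := by
  simp only [dIdx, lastIdx, Fin.last, ne_eq, Fin.mk.injEq]
  omega

theorem inner_eLast (d : ℕ) (v : EuclideanSpace ℝ (Fin (d + 1))) :
    ⟪v, eLast d⟫ = v (lastIdx d) := by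
  simp [eLast, EuclideanSpace.inner_single_right]

theorem inner_normalHr (d : ℕ) (r m : ℝ) (v : EuclideanSpace ℝ (Fin (d + 1))) :
    ⟪v, normalHr d r m⟫ = r * v (dIdx d) + m * v (lastIdx d) := by
  simp [normalHr, inner_add_right, real_inner_smul_right, inner_eLast,
    EuclideanSpace.inner_single_right]

theorem normalHr_ne_zero {d : ℕ} (hd : 1 ≤ d) (r : ℝ) {m : ℝ} (hm : m ≠ 0) :
    normalHr d r m ≠ 0 := by
  intro h
  have := congrArg (fun v : EuclideanSpace ℝ (Fin (d + 1)) => v (lastIdx d)) h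
  simp [normalHr, eLast, (dIdx_ne_lastIdx hd).symm, hm] at this

theorem tendsto_projHyp_normalHr {d : ℕ} (hd : 1 ≤ d) {m : ℝ} (hm : m ≠ 0)
    {v : EuclideanSpace ℝ (Fin (d + 1))} (hv : v (lastIdx d) = 0) :
    Tendsto (fun r => projHyp (normalHr d r m) (r * m) v) (𝓝 0) (𝓝 v) := by
  have hc : ContinuousAt (fun r => projHyp (normalHr d r m) (r * m) v) 0 := by
    have hn : Continuous fun r => normalHr d r m := by unfold normalHr; fun_prop
    have h₀ : ‖normalHr d 0 m‖ ^ 2 ≠ 0 :=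
      pow_ne_zero _ (norm_ne_zero_iff.mpr (normalHr_ne_zero hd 0 hm))
    unfold projHyp
    fun_prop (disch := assumption)
  have h := hc.tendsto
  simpa [projHyp, inner_normalHr, hv] using h

/-- The perturbations of a point `v` used to build the sets `A₊`, `A₋` and `B_H`. -/
noncomputable def perturb (d : ℕ) (m : ℝ) :
    SignType → EuclideanSpace ℝ (Fin (d + 1)) → ℝ → EuclideanSpace ℝ (Fin (d + 1))
  | .pos, v, r => v + r • eLast d
  | .neg, v, r => v - r • eLast d
  | .zero, v, r => projHyp (normalHr d r m) (r * m) v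

theorem tendsto_perturb {d : ℕ} (hd : 1 ≤ d) {m : ℝ} (hm : m ≠ 0) (s : SignType)
    {v : EuclideanSpace ℝ (Fin (d + 1))} (hv : v (lastIdx d) = 0) :
    Tendsto (perturb d m s v) (𝓝 0) (𝓝 v) := by
  have hr : Tendsto (fun r : ℝ => r • eLast d) (𝓝 0) (𝓝 0) := by
    have h : Continuous fun r : ℝ => r • eLast d := by fun_prop
    simpa using h.tendsto 0
  cases s with
  | pos =>
    have h := hr.const_add v
    rwa [add_zero] at h
  | neg =>
    have h := hr.const_sub v
    rwa [sub_zero] at h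
  | zero => exact tendsto_projHyp_normalHr hd hm hv

theorem mem_union_iff_perturb {d : ℕ} {X : Finset (EuclideanSpace ℝ (Fin (d + 1)))} {r m : ℝ}
    {x : EuclideanSpace ℝ (Fin (d + 1))} :
    x ∈ Aplus d X r ∪ Aminus d X r ∪ BHset d X r m ↔
      ∃ s, ∃ v ∈ X, (s = 0 ↔ v (dIdx d) ≠ 0) ∧ perturb d m s v r = x := by
  constructor
  · rintro ((⟨v, hv, rfl⟩ | ⟨v, hv, rfl⟩) | ⟨v, hv, rfl⟩)
    · exact ⟨.pos, v, hv.1, by simp [hv.2], rfl⟩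
    · exact ⟨.neg, v, hv.1, by simp [hv.2], rfl⟩
    · exact ⟨.zero, v, hv.1, by simpa using fun h => hv.2 ⟨hv.1, h⟩, rfl⟩
  · rintro ⟨s, v, hv, h, rfl⟩
    cases s with
    | pos => exact .inl (.inl ⟨v, ⟨hv, by simpa using h⟩, rfl⟩)
    | neg => exact .inl (.inr ⟨v, ⟨hv, by simpa using h⟩, rfl⟩)
    | zero => exact .inr ⟨v, ⟨hv, fun hA => by simp [hA.2] at h⟩, rfl⟩

theorem perturb_mem_of_eq_zero {d : ℕ} {X : Finset (EuclideanSpace ℝ (Fin (d + 1)))} {r m : ℝ}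
    {s : SignType} {v : EuclideanSpace ℝ (Fin (d + 1))} (hv : v ∈ X)
    (hs : s = 0 ↔ v (dIdx d) ≠ 0) (h : v (dIdx d) = 0) :
    perturb d m s v r ∈ Aplus d X r ∪ Aminus d X r := by
  cases s with
  | pos => exact .inl ⟨v, ⟨hv, h⟩, rfl⟩
  | neg => exact .inr ⟨v, ⟨hv, h⟩, rfl⟩
  | zero => simp [h] at hs

/-- The angle at one of the two points `a ± r • e` between the other one and a point of `H_r` is
acute if the `d`-th coordinate of the latter lies strictly between `0` and `2 * m`. -/
theorem inner_perturb_sub_pos {d : ℕ} (hd : 1 ≤ d) {r m : ℝ} (hr : 0 < r) (hm : 0 < m)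
    {a b : EuclideanSpace ℝ (Fin (d + 1))} (ha : a (lastIdx d) = 0) {s t : SignType}
    (hs : s ≠ 0) (ht : t ≠ 0) (hst : s ≠ t)
    (hb : perturb d m 0 b r (dIdx d) ∈ Set.Ioo 0 (2 * m)) :
    0 < ⟪perturb d m s a r - perturb d m t a r, perturb d m 0 b r - perturb d m t a r⟫ := by
  have hH := inner_projHyp (normalHr_ne_zero hd r hm.ne') (r * m) b
  rw [inner_normalHr] at hH
  change r * perturb d m 0 b r (dIdx d) + m * perturb d m 0 b r (lastIdx d) = r * m at hH
  generalize perturb d m 0 b r = p at hb hH ⊢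
  obtain ⟨h₀, h₁⟩ := hb
  have he : eLast d (lastIdx d) = 1 := by simp [eLast]
  have hlt : p (lastIdx d) < r := by
    nlinarith [mul_pos hr h₀]
  have hgt : -r < p (lastIdx d) := by
    nlinarith [mul_lt_mul_of_pos_left h₁ hr]
  cases s <;> cases t <;>
    first | exact absurd rfl hs | exact absurd rfl ht | exact absurd rfl hst | skip
  · have h : a - r • eLast d - (a + r • eLast d) = (-(2 * r)) • eLast d := by module
    simp only [perturb, h]
    rw [real_inner_smul_left, real_inner_comm, inner_eLast]
    simp only [PiLp.sub_apply, PiLp.add_apply, PiLp.smul_apply, he, ha, smul_eq_mul]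
    nlinarith
  · have h : a + r • eLast d - (a - r • eLast d) = (2 * r) • eLast d := by module
    simp only [perturb, h]
    rw [real_inner_smul_left, real_inner_comm, inner_eLast]
    simp only [PiLp.sub_apply, PiLp.smul_apply, he, ha, smul_eq_mul]
    nlinarith

/-- Proposition 3: if `X ⊆ ℝ^{d+1}` is a finite acute set with `x_{d+1} = 0` and
`0 ≤ x_d < m` for all `x ∈ X`, then for all sufficiently small `r > 0`, any three pairwise
distinct points of `A₊ ∪ A₋ ∪ B_H` not all lying in `A₊ ∪ A₋` form an acute triangle. -/
theorem acute_triangles_of_perturbed_sets (d : ℕ) (hd : 1 ≤ d)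
    (X : Finset (EuclideanSpace ℝ (Fin (d + 1))))
    (hX : IsAcuteSet (X : Set (EuclideanSpace ℝ (Fin (d + 1)))))
    (hlast : ∀ x ∈ X, x (lastIdx d) = 0)
    (hdth : ∀ x ∈ X, 0 ≤ x (dIdx d))
    (m : ℝ) (hm : 0 < m) (hmX : ∀ x ∈ X, x (dIdx d) < m) :
    ∃ r₀ > 0, ∀ r : ℝ, 0 < r → r < r₀ →
      ∀ x ∈ Aplus d X r ∪ Aminus d X r ∪ BHset d X r m,
      ∀ y ∈ Aplus d X r ∪ Aminus d X r ∪ BHset d X r m,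
      ∀ z ∈ Aplus d X r ∪ Aminus d X r ∪ BHset d X r m,
        x ≠ y → x ≠ z → y ≠ z →
        ¬(x ∈ Aplus d X r ∪ Aminus d X r ∧ y ∈ Aplus d X r ∪ Aminus d X r ∧
            z ∈ Aplus d X r ∪ Aminus d X r) →
        EuclideanGeometry.angle y x z < Real.pi / 2 ∧
        EuclideanGeometry.angle x y z < Real.pi / 2 ∧
        EuclideanGeometry.angle x z y < Real.pi / 2 := by
  have hq : ∀ s, ∀ v ∈ X, Tendsto (perturb d m s v) (𝓝[>] 0) (𝓝 v) := fun s v hv =>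
    (tendsto_perturb hd hm.ne' s (hlast v hv)).mono_left nhdsWithin_le_nhds
  have hcoord : ∀ᶠ r in 𝓝[>] (0 : ℝ), ∀ b ∈ X, b (dIdx d) ≠ 0 →
      perturb d m 0 b r (dIdx d) ∈ Set.Ioo 0 (2 * m) := by
    simp only [Finset.eventually_all, eventually_imp_distrib_left]
    intro b hb hb₀
    have hcont : Continuous fun v : EuclideanSpace ℝ (Fin (d + 1)) => v (dIdx d) := by fun_prop
    refine ((hcont.tendsto b).comp (hq 0 b hb)).eventually (Ioo_mem_nhds ?_ ?_)
    · exact (hdth b hb).lt_of_ne' hb₀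
    · linarith [hmX b hb]
  obtain ⟨r₀, hr₀, h⟩ :=
    mem_nhdsGT_iff_exists_Ioo_subset.mp ((hX.eventually_inner_pos hq).and hcoord)
  refine ⟨r₀, hr₀, fun r hr hrr₀ => ?_⟩
  obtain ⟨hacute, hcoord⟩ := h ⟨hr, hrr₀⟩
  have key : ∀ x ∈ Aplus d X r ∪ Aminus d X r ∪ BHset d X r m,
      ∀ y ∈ Aplus d X r ∪ Aminus d X r ∪ BHset d X r m,
      ∀ z ∈ Aplus d X r ∪ Aminus d X r ∪ BHset d X r m, x ≠ y → z ≠ y →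
        ¬(x ∈ Aplus d X r ∪ Aminus d X r ∧ y ∈ Aplus d X r ∪ Aminus d X r ∧
            z ∈ Aplus d X r ∪ Aminus d X r) →
        EuclideanGeometry.angle x y z < Real.pi / 2 := by
    intro x hx y hy z hz hxy hzy hn
    obtain ⟨i, a, ha, hi, rfl⟩ := mem_union_iff_perturb.mp hx
    obtain ⟨j, b, hb, hj, rfl⟩ := mem_union_iff_perturb.mp hy
    obtain ⟨k, c, hc, hk, rfl⟩ := mem_union_iff_perturb.mp hz
    rw [angle_lt_pi_div_two_iff_inner_pos]
    have same : ∀ s t w, ∀ u ∈ X, ∀ v ∈ X, (s = 0 ↔ u (dIdx d) ≠ 0) → (t = 0 ↔ u (dIdx d) ≠ 0) →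
        (w = 0 ↔ v (dIdx d) ≠ 0) → perturb d m s u r ≠ perturb d m t u r →
        ¬(perturb d m s u r ∈ Aplus d X r ∪ Aminus d X r ∧
          perturb d m t u r ∈ Aplus d X r ∪ Aminus d X r ∧
          perturb d m w v r ∈ Aplus d X r ∪ Aminus d X r) →
        0 < ⟪perturb d m s u r - perturb d m t u r, perturb d m w v r - perturb d m t u r⟫ := by
      intro s t w u hu v hv hs ht hw hne hnot
      have hst : s ≠ t := fun h => hne (by rw [h])
      have hu₀ : u (dIdx d) = 0 := by
        by_contra h
        exact hst ((hs.mpr h).trans (ht.mpr h).symm)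
      have hv₀ : v (dIdx d) ≠ 0 := fun h => hnot
        ⟨perturb_mem_of_eq_zero hu hs hu₀, perturb_mem_of_eq_zero hu ht hu₀,
          perturb_mem_of_eq_zero hv hw h⟩
      obtain rfl := hw.mpr hv₀
      exact inner_perturb_sub_pos hd hr hm (hlast u hu) (fun h => hs.mp h hu₀)
        (fun h => ht.mp h hu₀) hst (hcoord v hv hv₀)
    by_cases hab : a = b
    · subst hab
      exact same i j k a ha c hc hi hj hk hxy hn
    by_cases hcb : c = b
    · subst hcb
      rw [real_inner_comm]
      exact same k j i c hc a ha hk hj hi hzy fun h => hn ⟨h.2.2, h.2.1, h.1⟩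
    exact hacute i j k a ha b hb c hc hab hcb
  intro x hx y hy z hz hxy hxz hyz hn
  exact ⟨key y hy x hx z hz hxy.symm hxz.symm fun h => hn ⟨h.2.1, h.1, h.2.2⟩,
    key x hx y hy z hz hxy hyz.symm hn,
    key x hx z hz y hy hxz hyz fun h => hn ⟨h.1, h.2.2, h.2.1⟩⟩
end

section
/- Let d ≥ 2 and r > 0. Let A ⊆ ℝ^{d+1} be a finite set of points all of whose d-th and (d+1)-st coordinates are zero, let u ∈ ℝ^{d+1} be such that the hyperplane H = {x : ⟨x,u⟩ = 1} contains the affine subspace {x : x_d = 0, x_{d+1} = r}, and let B_H ⊆ H be a finite set. For each a ∈ A let C(a) = {a + s·e_d + t·e_{d+1} : s² + t² = r²} be the circle of radius r centered at a in the plane spanned by e_d and e_{d+1}. Then for every ε > 0 there exist a vector u' ∈ ℝ^{d+1} defining a hyperplane H₂ = {x : ⟨x,u'⟩ = 1} and a map φ : A → ℝ² such that: (1) dist(v, H₂) < ε for every v ∈ B_H; (2) for every a ∈ A, ‖φ(a)‖ = r, the point a + φ(a)₁·e_d + φ(a)₂·e_{d+1} lies in H₂ ∩ C(a) and is within distance ε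 of a + r·e_{d+1}; and (3) the 2|A| points {φ(a) : a ∈ A} ∪ {−φ(a) : a ∈ A} are pairwise distinct. -/
open scoped RealInnerProductSpace

/-- The standard basis vector `e_d` of `ℝ^{d+1}` (1-based indexing). -/
noncomputable def eD (d : ℕ) : EuclideanSpace ℝ (Fin (d + 1)) :=
  EuclideanSpace.single (dIdx d) 1

/-- `C(a)`: the circle of radius `r` centered at `a` in the plane spanned by `e_d` and
`e_{d+1}`. -/
def circleAt (d : ℕ) (r : ℝ) (a : EuclideanSpace ℝ (Fin (d + 1))) :
    Set (EuclideanSpace ℝ (Fin (d + 1))) :=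
  {x | ∃ s t : ℝ, s ^ 2 + t ^ 2 = r ^ 2 ∧ x = a + s • eD d + t • eLast d}

open Filter Topology

/-- A finite set in an inner product space is separated by its inner products with one vector. -/
lemma exists_injOn_inner {E : Type*} [NormedAddCommGroup E] [InnerProductSpace ℝ E]
    (A : Finset E) : ∃ w : E, Set.InjOn (fun a => ⟪a, w⟫) (A : Set E) := by
  obtain ⟨w, hw⟩ := Module.Dual.exists_forall_ne_zero_of_forall_exists
    (fun p : {p : A × A // p.1 ≠ p.2} => innerₛₗ ℝ ((p.1.1 : E) - p.1.2)) fun p =>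
      ⟨(p.1.1 : E) - p.1.2, by
        rw [innerₛₗ_apply_apply, inner_self_ne_zero, sub_ne_zero]
        exact Subtype.coe_injective.ne p.2⟩
  refine ⟨w, fun a ha b hb hab => ?_⟩
  by_contra hne
  refine hw ⟨(⟨a, ha⟩, ⟨b, hb⟩), fun h => hne (congrArg Subtype.val h)⟩ ?_
  simpa [inner_sub_left, sub_eq_zero] using hab

/-- The line `β s + t / r = c` with `β ≠ 0` and `c` close to `1` meets the circle of radius `r`
around the origin near `(0, r)`. -/
lemma eventually_exists_line_inter_circle {r β η : ℝ} (hr : 0 < r) (hβ : β ≠ 0) (hη : 0 < η) :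
    ∀ᶠ c in 𝓝 (1 : ℝ), ∃ s t : ℝ,
      s ^ 2 + t ^ 2 = r ^ 2 ∧ β * s + t / r = c ∧ 0 < t ∧ |s| + |t - r| < η := by
  set N : ℝ := β ^ 2 + 1 / r ^ 2 with hN
  have hNpos : 0 < N := by positivity
  let q : ℝ → ℝ := fun c => 1 + (1 - c ^ 2) / (r ^ 2 * β ^ 2)
  let k : ℝ → ℝ := fun c => r * β * √(q c) / N
  let s : ℝ → ℝ := fun c => c * β / N - k c / r
  let t : ℝ → ℝ := fun c => c / (r * N) + k c * β
  have hq : Continuous q := by fun_prop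
  have hk : Continuous k := by fun_prop
  have hs : Continuous s := by fun_prop
  have ht : Continuous t := by fun_prop
  have hq1 : q 1 = 1 := by simp [q]
  have hs1 : s 1 = 0 := by
    simp only [s, k, hq1, Real.sqrt_one]
    field_simp
    ring
  have ht1 : t 1 = r := by
    simp only [t, k, hq1, Real.sqrt_one, hN]
    field_simp
    ring
  have hd : Continuous fun c => |s c| + |t c - r| := by fun_prop
  filter_upwards [(hq.tendsto 1).eventually_const_lt (by rw [hq1]; exact one_pos : 0 < q 1),
    (ht.tendsto 1).eventually_const_lt (ht1.symm ▸ hr : 0 < t 1),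
    (hd.tendsto 1).eventually_lt_const (by simpa [hs1, ht1] using hη)] with c hqc htc hdc
  refine ⟨s c, t c, ?_, ?_, htc, hdc⟩
  · have hk2 : k c ^ 2 = (r ^ 2 * N - c ^ 2) / N ^ 2 := by
      simp only [k, div_pow, mul_pow, Real.sq_sqrt hqc.le]
      simp only [q, hN]
      field_simp
      ring
    have h : s c ^ 2 + t c ^ 2 = c ^ 2 / N + k c ^ 2 * N := by
      simp only [s, t, hN]
      field_simp
      ring
    rw [h, hk2]
    field_simp
    ring
  · simp only [s, t, hN]
    field_simp
    ring

/-- Proposition 4: given a finite set `A ⊆ ℝ^{d+1}` of points whose `d`-th and `(d+1)`-st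
coordinates vanish, a hyperplane `H = {x : ⟪x,u⟫ = 1}` containing
`{x : x_d = 0, x_{d+1} = r}`, and a finite set `B_H ⊆ H`, for every `ε > 0` one can find a
hyperplane `H₂ = {x : ⟪x,u'⟫ = 1}` that is `ε`-close to every point of `B_H`, and a map
`φ : A → ℝ²` with `‖φ(a)‖ = r` such that `a + φ(a)₁·e_d + φ(a)₂·e_{d+1} ∈ H₂ ∩ C(a)` is
within `ε` of `a + r·e_{d+1}`, and the `2|A|` vectors `±φ(a)` are pairwise distinct. -/
theorem exists_tilted_hyperplane (d : ℕ) (hd : 2 ≤ d) (r : ℝ) (hr : 0 < r)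
    (A : Finset (EuclideanSpace ℝ (Fin (d + 1))))
    (hA : ∀ a ∈ A, a (dIdx d) = 0 ∧ a (lastIdx d) = 0)
    (u : EuclideanSpace ℝ (Fin (d + 1)))
    (hu : ∀ x : EuclideanSpace ℝ (Fin (d + 1)),
      x (dIdx d) = 0 → x (lastIdx d) = r → ⟪x, u⟫ = 1)
    (BH : Finset (EuclideanSpace ℝ (Fin (d + 1))))
    (hBH : ∀ v ∈ BH, ⟪v, u⟫ = 1) :
    ∀ ε > 0, ∃ (u' : EuclideanSpace ℝ (Fin (d + 1)))
      (φ : EuclideanSpace ℝ (Fin (d + 1)) → EuclideanSpace ℝ (Fin 2)),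
      (∀ v ∈ BH, Metric.infDist v {x : EuclideanSpace ℝ (Fin (d + 1)) | ⟪x, u'⟫ = 1} < ε) ∧
      (∀ a ∈ A, ‖φ a‖ = r ∧
        ⟪a + (φ a 0) • eD d + (φ a 1) • eLast d, u'⟫ = 1 ∧
        a + (φ a 0) • eD d + (φ a 1) • eLast d ∈ circleAt d r a ∧
        dist (a + (φ a 0) • eD d + (φ a 1) • eLast d) (a + r • eLast d) < ε) ∧
      Set.InjOn φ (A : Set (EuclideanSpace ℝ (Fin (d + 1)))) ∧
      (∀ a ∈ A, ∀ b ∈ A, φ a ≠ -φ b) := by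
  intro ε hε
  obtain ⟨w₀, hw₀⟩ := exists_injOn_inner A
  have hne : dIdx d ≠ lastIdx d := by
    simp only [dIdx, lastIdx, Fin.last, ne_eq, Fin.mk.injEq]
    omega
  have inner_eD : ∀ x : EuclideanSpace ℝ (Fin (d + 1)), ⟪eD d, x⟫ = x (dIdx d) := fun x => by
    simp [eD, EuclideanSpace.inner_single_left]
  have inner_eLast : ∀ x : EuclideanSpace ℝ (Fin (d + 1)), ⟪eLast d, x⟫ = x (lastIdx d) :=
    fun x => by simp [eLast, EuclideanSpace.inner_single_left]
  have eD_d : eD d (dIdx d) = 1 := by simp [eD]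
  have eD_last : eD d (lastIdx d) = 0 := by simp [eD, hne.symm]
  have eLast_d : eLast d (dIdx d) = 0 := by simp [eLast, hne]
  have eLast_last : eLast d (lastIdx d) = 1 := by simp [eLast]
  have norm_eD : ‖eD d‖ = 1 := by simp [eD]
  have norm_eLast : ‖eLast d‖ = 1 := by simp [eLast]
  have hAD : ∀ a ∈ A, ⟪a, eD d⟫ = 0 := fun a ha => by
    rw [real_inner_comm, inner_eD, (hA a ha).1]
  have hAL : ∀ a ∈ A, ⟪a, eLast d⟫ = 0 := fun a ha => by
    rw [real_inner_comm, inner_eLast, (hA a ha).2]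
  obtain ⟨w, hwD, hwL, hw⟩ : ∃ w : EuclideanSpace ℝ (Fin (d + 1)),
      w (dIdx d) = 0 ∧ w (lastIdx d) = 0 ∧ Set.InjOn (fun a => ⟪a, w⟫) (A : Set _) := by
    refine ⟨w₀ - w₀ (dIdx d) • eD d - w₀ (lastIdx d) • eLast d, ?_, ?_, ?_⟩
    · simp [eD_d, eLast_d]
    · simp [eD_last, eLast_last]
    · refine hw₀.congr fun a ha => ?_
      simp [inner_sub_right, inner_smul_right, hAD a ha, hAL a ha]
  have hu_last : u (lastIdx d) = 1 / r := by
    have h := hu (r • eLast d) (by simp [eLast_d]) (by simp [eLast_last])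
    rw [real_inner_smul_left, inner_eLast] at h
    field_simp
    linarith
  have hAu : ∀ a ∈ A, ⟪a, u⟫ = 0 := fun a ha => by
    have h := hu (a + r • eLast d) (by simp [eLast_d, hA a ha]) (by simp [eLast_last, hA a ha])
    rw [inner_add_left, real_inner_smul_left, inner_eLast, hu_last, mul_one_div_cancel hr.ne'] at h
    linarith
  obtain ⟨δ, hβ, hδ⟩ : ∃ δ : ℝ, u (dIdx d) + δ ≠ 0 ∧
      ∀ v ∈ BH, |r * (δ * v (dIdx d))| < ε := by
    have h₁ : ∀ᶠ δ in 𝓝[≠] (0 : ℝ), ∀ v ∈ BH, |r * (δ * v (dIdx d))| < ε := by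
      refine nhdsWithin_le_nhds ((eventually_all_finset BH).2 fun v _ => ?_)
      have hc : Continuous fun δ : ℝ => |r * (δ * v (dIdx d))| := by fun_prop
      exact (hc.tendsto 0).eventually_lt_const (by simpa using hε)
    have h₂ : ∀ᶠ δ in 𝓝[≠] (0 : ℝ), u (dIdx d) + δ ≠ 0 := by
      by_cases h : u (dIdx d) = 0
      · filter_upwards [self_mem_nhdsWithin] with δ hδ
        simpa [h] using hδ
      · have hc : Continuous fun δ : ℝ => u (dIdx d) + δ := by fun_prop
        exact nhdsWithin_le_nhds ((hc.tendsto 0).eventually_ne (by simpa using h))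
    exact (h₂.and h₁).exists
  obtain ⟨l, hl, hlB, hlA⟩ : ∃ l : ℝ, l ≠ 0 ∧
      (∀ v ∈ BH, |r * (δ * v (dIdx d) + l * ⟪v, w⟫)| < ε) ∧
      ∀ a ∈ A, ∃ s t : ℝ, s ^ 2 + t ^ 2 = r ^ 2 ∧
        (u (dIdx d) + δ) * s + t / r = 1 - l * ⟪a, w⟫ ∧ 0 < t ∧ |s| + |t - r| < ε := by
    have h₁ : ∀ᶠ l in 𝓝 (0 : ℝ), ∀ v ∈ BH, |r * (δ * v (dIdx d) + l * ⟪v, w⟫)| < ε := by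
      refine (eventually_all_finset BH).2 fun v hv => ?_
      have hc : Continuous fun l : ℝ => |r * (δ * v (dIdx d) + l * ⟪v, w⟫)| := by fun_prop
      exact (hc.tendsto 0).eventually_lt_const (by simpa using hδ v hv)
    have h₂ : ∀ᶠ l in 𝓝 (0 : ℝ), ∀ a ∈ A, ∃ s t : ℝ, s ^ 2 + t ^ 2 = r ^ 2 ∧
        (u (dIdx d) + δ) * s + t / r = 1 - l * ⟪a, w⟫ ∧ 0 < t ∧ |s| + |t - r| < ε := by
      refine (eventually_all_finset A).2 fun a _ => ?_
      have hc : Tendsto (fun l : ℝ => 1 - l * ⟪a, w⟫) (𝓝 0) (𝓝 1) :=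
        Continuous.tendsto' (by fun_prop) _ _ (by simp)
      exact hc.eventually (eventually_exists_line_inter_circle hr hβ hε)
    have h₃ : ∀ᶠ l in 𝓝[≠] (0 : ℝ), l ≠ 0 := self_mem_nhdsWithin
    exact (h₃.and (nhdsWithin_le_nhds (h₁.and h₂))).exists
  choose! s t hcirc hline hpos hclose using hlA
  have hinner : ∀ v, ⟪v, u + δ • eD d + l • w⟫ = ⟪v, u⟫ + δ * v (dIdx d) + l * ⟪v, w⟫ := by
    intro v
    rw [inner_add_right, inner_add_right, real_inner_smul_right, real_inner_smul_right,
      real_inner_comm (eD d) v, inner_eD]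
  refine ⟨u + δ • eD d + l • w, fun a => !₂[s a, t a], fun v hv => ?_, fun a ha => ?_, ?_, ?_⟩
  · set ρ := r * (δ * v (dIdx d) + l * ⟪v, w⟫) with hρ
    have hmem : v - ρ • eLast d ∈ {x | ⟪x, u + δ • eD d + l • w⟫ = 1} := by
      rw [Set.mem_ofPred_eq, inner_sub_left, real_inner_smul_left, hinner, hinner, hBH v hv,
        inner_eLast, inner_eLast, hu_last, hwL, eLast_d, hρ]
      field_simp
      ring
    refine (Metric.infDist_le_dist_of_mem hmem).trans_lt ?_
    simp only [dist_eq_norm, sub_sub_cancel, norm_smul, norm_eLast, mul_one]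
    exact hlB v hv
  · refine ⟨?_, ?_, ⟨_, _, hcirc a ha, rfl⟩, ?_⟩
    · rw [EuclideanSpace.norm_eq, Fin.sum_univ_two]
      simp [hcirc a ha, hr.le]
    · have h := hline a ha
      simp only [hinner, inner_add_left, real_inner_smul_left, inner_eD, inner_eLast, hAu a ha,
        hu_last, hwD, hwL, PiLp.add_apply, PiLp.smul_apply, eD_d, eLast_d, (hA a ha).1]
      simp
      simp [div_eq_mul_inv] at h
      linarith
    · have h : a + s a • eD d + t a • eLast d - (a + r • eLast d) =
          s a • eD d + (t a - r) • eLast d := by module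
      refine lt_of_le_of_lt ?_ (hclose a ha)
      simp only [dist_eq_norm]
      refine (congrArg norm h).trans_le ((norm_add_le _ _).trans_eq ?_)
      simp [norm_smul, norm_eD, norm_eLast]
  · intro a ha b hb hab
    have h0 : s a = s b := by simpa using congrArg (fun x => x 0) hab
    have h1 : t a = t b := by simpa using congrArg (fun x => x 1) hab
    refine hw ha hb (mul_left_cancel₀ hl ?_)
    have ha' := hline a ha
    have hb' := hline b hb
    rw [h0, h1] at ha'
    linarith
  · intro a ha b hb hab
    have h1 : t a = -t b := by simpa using congrArg (fun x => x 1) hab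
    linarith [hpos a ha, hpos b hb]
end
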